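/- arXiv:gr-qc/9906087 — 5 statements merged into one kernel-verified Lean document; each statement's English description precedes it below -/
import Mathlib

section
/- Let 1 ≤ p ≤ n. For every p-form Σ on n-dimensional Minkowski space and all future-pointing causal vectors u and v, the basic super-energy tensor of Σ satisfies T{Σ}_{λμ} u^λ v^μ ≥ 0 (the dominant super-energy property for simple p-forms). -/
open Finset

noncomputable section

/-- Components of the Minkowski metric (and of its inverse) in dimension `n`. -/
def gmet (n : ℕ) (μ ν : Fin n) : ℝ :=
  if μ = ν then (if (μ : ℕ) = 0 then -1 else 1) else 0

/-- Minkowski square `η_{μν} v^μ v^ν` of a vector. -/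
def minkSq (n : ℕ) (v : Fin n → ℝ) : ℝ :=
  ∑ μ : Fin n, ∑ ν : Fin n, gmet n μ ν * v μ * v ν

/-- A `p`-form: a totally antisymmetric `p`-index covariant tensor. -/
def IsPForm (n p : ℕ) (S : (Fin p → Fin n) → ℝ) : Prop :=
  ∀ (σ : Equiv.Perm (Fin p)) (μ : Fin p → Fin n),
    S (μ ∘ σ) = ((Equiv.Perm.sign σ : ℤ) : ℝ) * S μ

/-- The contraction `Σ_{λρ₂…ρ_p} Σ_μ{}^{ρ₂…ρ_p}`. -/
def partContract (n p : ℕ) (hp : 0 < p) (S : (Fin p → Fin n) → ℝ) (lam mu : Fin n) : ℝ :=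
  ∑ ρ : Fin p → Fin n, ∑ τ : Fin p → Fin n,
    if ρ ⟨0, hp⟩ = lam ∧ τ ⟨0, hp⟩ = mu then
      S ρ * S τ *
        ∏ i ∈ Finset.univ.filter (fun i => i ≠ (⟨0, hp⟩ : Fin p)), gmet n (ρ i) (τ i)
    else 0

/-- The full contraction `Σ_{ρ₁…ρ_p} Σ^{ρ₁…ρ_p}`. -/
def fullContract (n p : ℕ) (S : (Fin p → Fin n) → ℝ) : ℝ :=
  ∑ ρ : Fin p → Fin n, ∑ τ : Fin p → Fin n,
    S ρ * S τ * ∏ i : Fin p, gmet n (ρ i) (τ i)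

/-- The basic super-energy tensor `T{Σ}_{λμ}` of a `p`-form. -/
def seT (n p : ℕ) (hp : 0 < p) (S : (Fin p → Fin n) → ℝ) (lam mu : Fin n) : ℝ :=
  (1 / ((p - 1).factorial : ℝ)) * partContract n p hp S lam mu
    - (1 / (2 * (p.factorial : ℝ))) * gmet n lam mu * fullContract n p S

/-- Recursive contraction of two families of tensors with a bilinear form. -/
def cQ {n : ℕ} (M : Fin n → Fin n → ℝ) :
    ℕ → (List (Fin n) → ℝ) → (List (Fin n) → ℝ) → ℝ
  | 0, F, G => F [] * G []
  | m + 1, F, G => ∑ a, ∑ b, M a b * cQ M m (fun l => F (a :: l)) (fun l => G (b :: l))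

/-- Interior product. -/
def ins {n : ℕ} (u : Fin n → ℝ) (F : List (Fin n) → ℝ) : List (Fin n) → ℝ :=
  fun l => ∑ a, u a * F (a :: l)

/-- Antisymmetry. -/
def Anti {n : ℕ} (F : List (Fin n) → ℝ) : Prop :=
  ∀ (pre : List (Fin n)) (a b : Fin n) (suf : List (Fin n)),
    F (pre ++ a :: b :: suf) = - F (pre ++ b :: a :: suf)

theorem cQ_sum_left {n : ℕ} (M : Fin n → Fin n → ℝ) (m : ℕ) (u : Fin n → ℝ)
    (F : Fin n → List (Fin n) → ℝ) (G : List (Fin n) → ℝ) :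
    cQ M m (fun l => ∑ c, u c * F c l) G = ∑ c, u c * cQ M m (F c) G := by
  induction m generalizing F G with
  | zero => simp [cQ, Finset.sum_mul, mul_assoc]
  | succ m ih =>
    simp only [cQ]
    simp_rw [ih, Finset.mul_sum]
    conv_rhs => rw [Finset.sum_comm]
    refine Finset.sum_congr rfl fun a _ => ?_
    rw [Finset.sum_comm]
    refine Finset.sum_congr rfl fun b _ => Finset.sum_congr rfl fun c _ => by ring

theorem cQ_sum_right {n : ℕ} (M : Fin n → Fin n → ℝ) (m : ℕ) (u : Fin n → ℝ)
    (F : List (Fin n) → ℝ) (G : Fin n → List (Fin n) → ℝ) :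
    cQ M m F (fun l => ∑ c, u c * G c l) = ∑ c, u c * cQ M m F (G c) := by
  induction m generalizing F G with
  | zero => simp [cQ, Finset.mul_sum, mul_left_comm]
  | succ m ih =>
    simp only [cQ]
    simp_rw [ih, Finset.mul_sum]
    conv_rhs => rw [Finset.sum_comm]
    refine Finset.sum_congr rfl fun a _ => ?_
    rw [Finset.sum_comm]
    refine Finset.sum_congr rfl fun b _ => Finset.sum_congr rfl fun c _ => by ring

theorem cQ_neg_left {n : ℕ} (M : Fin n → Fin n → ℝ) (m : ℕ) (F G : List (Fin n) → ℝ) :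
    cQ M m (fun l => - F l) G = - cQ M m F G := by
  induction m generalizing F G with
  | zero => simp [cQ]
  | succ m ih => simp only [cQ, ih, mul_neg, Finset.sum_neg_distrib]

theorem cQ_neg_right {n : ℕ} (M : Fin n → Fin n → ℝ) (m : ℕ) (F G : List (Fin n) → ℝ) :
    cQ M m F (fun l => - G l) = - cQ M m F G := by
  induction m generalizing F G with
  | zero => simp [cQ]
  | succ m ih => simp only [cQ, ih, mul_neg, Finset.sum_neg_distrib]

theorem cQ_zero_left {n : ℕ} (M : Fin n → Fin n → ℝ) (m : ℕ) (G : List (Fin n) → ℝ) :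
    cQ M m (fun _ => 0) G = 0 := by
  induction m generalizing G with
  | zero => simp [cQ]
  | succ m ih => simp [cQ, ih]

theorem cQ_ins_ins {n : ℕ} (M : Fin n → Fin n → ℝ) (m : ℕ) (u v : Fin n → ℝ)
    (F G : List (Fin n) → ℝ) :
    cQ M m (ins u F) (ins v G)
      = ∑ a, ∑ b, (u a * v b) * cQ M m (fun l => F (a :: l)) (fun l => G (b :: l)) := by
  unfold ins
  rw [cQ_sum_left M m u (fun a l => F (a :: l))]
  refine Finset.sum_congr rfl fun a _ => ?_
  rw [cQ_sum_right M m v _ (fun a l => G (a :: l)), Finset.mul_sum]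
  refine Finset.sum_congr rfl fun b _ => by ring

theorem Anti.cons {n : ℕ} {F : List (Fin n) → ℝ} (h : Anti F) (a : Fin n) :
    Anti (fun l => F (a :: l)) := fun pre x y suf => h (a :: pre) x y suf

theorem Anti.ins {n : ℕ} {F : List (Fin n) → ℝ} (h : Anti F) (u : Fin n → ℝ) :
    Anti (ins u F) := fun pre x y suf => by
  simp only [_root_.ins, ← Finset.sum_neg_distrib]
  refine Finset.sum_congr rfl fun a _ => ?_
  rw [← mul_neg]
  exact congrArg _ (h (a :: pre) x y suf)

theorem ins_cons {n : ℕ} {F : List (Fin n) → ℝ} (h : Anti F) (u : Fin n → ℝ) (a : Fin n) :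
    (fun l => ins u F (a :: l)) = fun l => - ins u (fun l => F (a :: l)) l := by
  funext l
  simp only [ins, ← Finset.sum_neg_distrib]
  refine Finset.sum_congr rfl fun c _ => ?_
  rw [← mul_neg]
  exact congrArg _ (h [] c a l)

theorem ins_neg {n : ℕ} (F : List (Fin n) → ℝ) (u : Fin n → ℝ) :
    ins u (fun l => - F l) = fun l => - ins u F l := by
  funext l
  simp [ins]

theorem ins_swap {n : ℕ} {F : List (Fin n) → ℝ} (h : Anti F) (u v : Fin n → ℝ) :
    ins v (ins u F) = fun l => - ins u (ins v F) l := by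
  funext l
  simp only [ins, ← Finset.sum_neg_distrib, Finset.mul_sum]
  rw [Finset.sum_comm]
  refine Finset.sum_congr rfl fun a _ => ?_
  refine Finset.sum_congr rfl fun b _ => ?_
  have := h [] a b l
  simp only [List.nil_append] at this
  rw [this]; ring

theorem ins_self {n : ℕ} {F : List (Fin n) → ℝ} (h : Anti F) (u : Fin n → ℝ) :
    ins u (ins u F) = fun _ => 0 := by
  funext l
  have := congrFun (ins_swap h u u) l
  linarith

theorem cQ_expand {n : ℕ} (G : Fin n → Fin n → ℝ) (t : ℝ) (u v : Fin n → ℝ) (m : ℕ)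
    (F F' : List (Fin n) → ℝ) (hF : Anti F) (hF' : Anti F') :
    cQ (fun a b => G a b + t * (u a * v b + v a * u b)) m F F'
      = cQ G m F F' + t * m * (cQ G (m - 1) (ins u F) (ins v F')
          + cQ G (m - 1) (ins v F) (ins u F'))
        - t ^ 2 * m * (m - 1) * cQ G (m - 2) (ins u (ins v F)) (ins u (ins v F')) := by
  induction m generalizing F F' with
  | zero => simp [cQ]
  | succ m ih =>
    set H : Fin n → Fin n → ℝ := fun a b => G a b + t * (u a * v b + v a * u b) with hH
    have h1 : cQ H (m + 1) F F'
        = ∑ a, ∑ b, G a b * cQ H m (fun l => F (a :: l)) (fun l => F' (b :: l))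
          + t * (cQ H m (ins u F) (ins v F') + cQ H m (ins v F) (ins u F')) := by
      rw [cQ_ins_ins, cQ_ins_ins]
      simp only [cQ, mul_add, Finset.mul_sum, ← Finset.sum_add_distrib]
      refine Finset.sum_congr rfl fun a _ => Finset.sum_congr rfl fun b _ => ?_
      simp only [hH]; ring
    have h2 : ∀ x y : Fin n → ℝ, (m : ℝ) * ∑ a, ∑ b, G a b * cQ G (m - 1)
        (ins x fun l => F (a :: l)) (ins y fun l => F' (b :: l))
        = m * cQ G m (ins x F) (ins y F') := by
      intro x y
      rcases m with _ | k
      · simp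
      · simp only [cQ, ins_cons hF, ins_cons hF', cQ_neg_left, cQ_neg_right, neg_neg,
          Nat.add_sub_cancel]
    have h3 : (m : ℝ) * (m - 1) * ∑ a, ∑ b, G a b * cQ G (m - 2)
        (ins u (ins v fun l => F (a :: l))) (ins u (ins v fun l => F' (b :: l)))
        = m * (m - 1) * cQ G (m - 1) (ins u (ins v F)) (ins u (ins v F')) := by
      rcases m with _ | _ | k
      · simp
      · simp
      · simp only [Nat.add_sub_cancel, Nat.reduceSubDiff, cQ, ins_cons (hF.ins v),
          ins_cons (hF'.ins v), ins_cons hF, ins_cons hF', ins_neg, cQ_neg_left, cQ_neg_right,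
          neg_neg]
    have h4 : ∑ a, ∑ b, G a b * cQ H m (fun l => F (a :: l)) (fun l => F' (b :: l))
        = cQ G (m + 1) F F' + t * (m * cQ G m (ins u F) (ins v F')
          + m * cQ G m (ins v F) (ins u F'))
          - t ^ 2 * (m * (m - 1) * cQ G (m - 1) (ins u (ins v F)) (ins u (ins v F'))) := by
      rw [← h2, ← h2, ← h3]
      simp only [ih _ _ (hF.cons _) (hF'.cons _)]
      simp only [cQ, Finset.mul_sum, ← Finset.sum_add_distrib, ← Finset.sum_sub_distrib]
      refine Finset.sum_congr rfl fun a _ => Finset.sum_congr rfl fun b _ => ?_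
      ring
    rw [h1, h4, ih _ _ (hF.ins u) (hF'.ins v), ih _ _ (hF.ins v) (hF'.ins u)]
    have z : ∀ x : Fin n → ℝ, ins x (fun _ => (0 : ℝ)) = fun _ => 0 := by
      intro x; funext l; simp [ins]
    have e1 : ins u (ins v (ins u F)) = fun _ => 0 := by
      rw [ins_swap hF u v, ins_neg, ins_self (hF.ins v)]; simp
    have e2 : ins u (ins v (ins v F)) = fun _ => 0 := by
      rw [ins_self hF v, z]
    rw [e1, e2, ins_self hF u, ins_self hF v, ins_swap hF u v, ins_swap hF' u v]
    simp only [cQ_zero_left, cQ_neg_left, cQ_neg_right]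
    have e3 : m + 1 - 2 = m - 1 := by omega
    rw [e3, Nat.add_sub_cancel]
    push_cast
    ring

theorem cQ_nonneg {n : ℕ} (H : Fin n → Fin n → ℝ) (hH : (Matrix.of H).PosSemidef) (m : ℕ)
    (F : List (Fin n) → ℝ) : 0 ≤ cQ H m F F := by
  obtain ⟨r, B, hB⟩ : ∃ (r : ℕ) (B : Fin r → Fin n → ℝ), ∀ a b, H a b = ∑ k, B k a * B k b := by
    obtain ⟨r, B, hB⟩ := Matrix.posSemidef_iff_eq_sum_vecMulVec.mp hH
    refine ⟨r, B, fun a b => ?_⟩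
    have h := congrFun (congrFun hB a) b
    simpa [Matrix.sum_apply, Matrix.vecMulVec_apply] using h
  induction m generalizing F with
  | zero => exact mul_self_nonneg _
  | succ m ih =>
    have : cQ H (m + 1) F F = ∑ k, cQ H m (ins (B k) F) (ins (B k) F) := by
      simp only [cQ_ins_ins]
      rw [cQ, Finset.sum_comm]
      simp only [hB, Finset.sum_mul]
      rw [Finset.sum_comm]
      conv_rhs => rw [Finset.sum_comm]
      refine Finset.sum_congr rfl fun a _ => ?_
      conv_rhs => rw [Finset.sum_comm]
    rw [this]
    exact Finset.sum_nonneg fun k _ => ih _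

theorem cQ_eq_sum {n : ℕ} (M : Fin n → Fin n → ℝ) (m : ℕ) (F G : List (Fin n) → ℝ) :
    cQ M m F G = ∑ ρ : Fin m → Fin n, ∑ τ : Fin m → Fin n,
      F (List.ofFn ρ) * G (List.ofFn τ) * ∏ i, M (ρ i) (τ i) := by
  induction m generalizing F G with
  | zero => simp [cQ]
  | succ m ih =>
    rw [← (Fin.consEquiv fun _ => Fin n).sum_comp, Fintype.sum_prod_type]
    rw [cQ]
    refine Finset.sum_congr rfl fun a _ => ?_
    simp_rw [← (Fin.consEquiv fun _ : Fin (m + 1) => Fin n).sum_comp, Fintype.sum_prod_type, ih,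
      Finset.mul_sum]
    rw [Finset.sum_comm]
    refine Finset.sum_congr rfl fun ρ _ => ?_
    refine Finset.sum_congr rfl fun b _ => ?_
    refine Finset.sum_congr rfl fun τ _ => ?_
    simp [Fin.consEquiv, Fin.prod_univ_succ, List.ofFn_succ]
    ring

/-- Extension of a tensor to lists. -/
def toL {n p : ℕ} (S : (Fin p → Fin n) → ℝ) : List (Fin n) → ℝ :=
  fun l => if h : l.length = p then S (fun i => l[(i : ℕ)]'(by have := i.2; omega)) else 0

theorem toL_ofFn {n p : ℕ} (S : (Fin p → Fin n) → ℝ) (ρ : Fin p → Fin n) :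
    toL S (List.ofFn ρ) = S ρ := by
  simp [toL]

theorem toL_anti {n p : ℕ} (S : (Fin p → Fin n) → ℝ) (hS : IsPForm n p S) : Anti (toL S) := by
  intro pre a b suf
  unfold toL
  by_cases h : (pre ++ a :: b :: suf).length = p
  · have h' : (pre ++ b :: a :: suf).length = p := by simpa using h
    rw [dif_pos h, dif_pos h']
    have hl : pre.length + 1 < p := by simp at h; omega
    have := hS (Equiv.swap ⟨pre.length, by omega⟩ ⟨pre.length + 1, hl⟩)
      (fun i => (pre ++ b :: a :: suf)[(i : ℕ)]'(by have := i.2; omega))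
    rw [Equiv.Perm.sign_swap (by simp)] at this
    simp only [Units.val_neg, Units.val_one, Int.cast_neg, Int.cast_one, neg_mul, one_mul] at this
    rw [← this]
    congr 1
    funext i
    simp only [Function.comp]
    by_cases h1 : i = ⟨pre.length, by omega⟩
    · subst h1; simp
    by_cases h2 : i = ⟨pre.length + 1, hl⟩
    · subst h2; simp
    rw! [Equiv.swap_apply_of_ne_of_ne h1 h2]
    have h1' : (i : ℕ) ≠ pre.length := fun hh => h1 (Fin.ext hh)
    have h2' : (i : ℕ) ≠ pre.length + 1 := fun hh => h2 (Fin.ext hh)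
    grind
  · have h' : ¬ (pre ++ b :: a :: suf).length = p := by simpa using h
    rw [dif_neg h, dif_neg h']; simp

theorem part_eq {n q : ℕ} (hp : 0 < q + 1) (S : (Fin (q + 1) → Fin n) → ℝ) (a b : Fin n) :
    partContract n (q + 1) hp S a b
      = cQ (gmet n) q (fun l => toL S (a :: l)) (fun l => toL S (b :: l)) := by
  have hprod : ∀ f : Fin (q + 1) → ℝ,
      ∏ i ∈ Finset.univ.filter (fun i => i ≠ (⟨0, hp⟩ : Fin (q + 1))), f i
        = ∏ i : Fin q, f i.succ := by
    intro f
    rw [Finset.prod_filter, Fin.prod_univ_succ]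
    simp [Fin.ext_iff]
  have hc : ∀ (c : Fin n) (ρ : Fin q → Fin n),
      toL S (c :: List.ofFn ρ) = S (Fin.cons c ρ) := by
    intro c ρ
    rw [← toL_ofFn S]; simp [List.ofFn_succ]
  rw [cQ_eq_sum, partContract]
  rw [← (Fin.consEquiv fun _ => Fin n).sum_comp, Fintype.sum_prod_type]
  simp_rw [← (Fin.consEquiv fun _ : Fin (q + 1) => Fin n).sum_comp, Fintype.sum_prod_type, hprod,
    hc]
  rw [Finset.sum_eq_single a]
  · refine Finset.sum_congr rfl fun ρ _ => ?_
    rw [Finset.sum_eq_single b]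
    · refine Finset.sum_congr rfl fun τ _ => ?_
      simp [Fin.consEquiv]
    · intro c _ hcb
      refine Finset.sum_eq_zero fun τ _ => ?_
      rw [if_neg]
      rintro ⟨_, h⟩
      exact hcb h
    · simp
  · intro c _ hcb
    refine Finset.sum_eq_zero fun ρ _ => Finset.sum_eq_zero fun d _ =>
      Finset.sum_eq_zero fun τ _ => ?_
    rw [if_neg]
    rintro ⟨h, _⟩
    exact hcb h
  · simp

/-- Minkowski product. -/
def mkp {n : ℕ} (u v : Fin n → ℝ) : ℝ := ∑ a, ∑ b, gmet n a b * u a * v b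

theorem mkp_eq {N : ℕ} (u v : Fin (N + 1) → ℝ) :
    mkp u v = - (u 0 * v 0) + ∑ i : Fin N, u i.succ * v i.succ := by
  simp [mkp, gmet, ite_mul, Fin.sum_univ_succ]

theorem cs {N : ℕ} (x y : Fin N → ℝ) (a b : ℝ) (ha : 0 ≤ a) (hb : 0 ≤ b)
    (hx : ∑ i, x i * x i ≤ a ^ 2) (hy : ∑ i, y i * y i ≤ b ^ 2) :
    |∑ i, x i * y i| ≤ a * b := by
  apply abs_le_of_sq_le_sq _ (by positivity)
  have h := Finset.sum_mul_sq_le_sq_mul_sq Finset.univ x y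
  have h0 : 0 ≤ ∑ i, y i * y i := Finset.sum_nonneg fun i _ => mul_self_nonneg _
  simp only [pow_two (x _), pow_two (y _)] at h
  calc _ ≤ _ := h
    _ ≤ a ^ 2 * b ^ 2 := mul_le_mul hx hy h0 (by positivity)
    _ = _ := by ring

/-- Key positivity for one-forms. -/
theorem one_form {N : ℕ} (u v w : Fin (N + 1) → ℝ) (hu : mkp u u ≤ 0) (hv : mkp v v ≤ 0)
    (hu0 : 0 ≤ u 0) (hv0 : 0 ≤ v 0) :
    0 ≤ 2 * mkp u w * mkp v w - mkp u v * mkp w w := by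
  set X : Fin (N + 1) → ℝ := fun i => mkp w w * u i - 2 * mkp u w * w i with hX
  have lin : ∀ y, mkp X y = mkp w w * mkp u y - 2 * mkp u w * mkp w y := by
    intro y
    simp only [mkp, hX, Finset.mul_sum, ← Finset.sum_sub_distrib]
    refine Finset.sum_congr rfl fun a _ => Finset.sum_congr rfl fun b _ => by ring
  have comm : ∀ x y : Fin (N + 1) → ℝ, mkp x y = mkp y x := by
    intro x y; simp only [mkp_eq, mul_comm]
  have hXX : mkp X X ≤ 0 := by
    have : mkp X X = (mkp w w) ^ 2 * mkp u u := by
      rw [lin, comm u X, comm w X, lin, lin, comm w u]; ring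
    rw [this]; exact mul_nonpos_of_nonneg_of_nonpos (sq_nonneg _) hu
  have hW : 0 ≤ ∑ i : Fin N, w i.succ * w i.succ := Finset.sum_nonneg fun i _ => mul_self_nonneg _
  have hX0 : 0 ≤ X 0 := by
    have e1 := mkp_eq u w
    have e2 := mkp_eq w w
    have e3 := mkp_eq u u
    have c := cs (fun i : Fin N => u i.succ) (fun i : Fin N => w i.succ) (u 0)
      (Real.sqrt (∑ i : Fin N, w i.succ * w i.succ)) hu0 (Real.sqrt_nonneg _)
      (by nlinarith) (by rw [Real.sq_sqrt hW])
    set W := ∑ i : Fin N, w i.succ * w i.succ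
    have hs := Real.sq_sqrt hW
    set s := Real.sqrt W
    set P := ∑ i : Fin N, u i.succ * w i.succ
    have : X 0 = u 0 * (w 0 ^ 2 + s ^ 2) - 2 * w 0 * P := by
      simp only [hX]; rw [e1, e2, hs]; ring
    rw [this]
    have c2 : w 0 * P ≤ |w 0| * (u 0 * s) := by
      calc _ ≤ |w 0 * P| := le_abs_self _
        _ = |w 0| * |P| := abs_mul _ _
        _ ≤ _ := mul_le_mul_of_nonneg_left c (abs_nonneg _)
    nlinarith [mul_nonneg hu0 (sq_nonneg (|w 0| - s)), sq_abs (w 0)]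
  have c := cs (fun i : Fin N => X i.succ) (fun i : Fin N => v i.succ) (X 0) (v 0) hX0 hv0
      (by rw [mkp_eq] at hXX; nlinarith) (by rw [mkp_eq] at hv; nlinarith)
  have h1 := lin v
  rw [mkp_eq] at h1
  have := (abs_le.mp c).2
  rw [comm w v] at h1
  nlinarith

/-- The covector contraction form of the positive matrix. -/
theorem psd {N : ℕ} (u v : Fin (N + 1) → ℝ) (hu : mkp u u ≤ 0) (hv : mkp v v ≤ 0)
    (hu0 : 0 ≤ u 0) (hv0 : 0 ≤ v 0) (hneg : mkp u v < 0) :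
    Matrix.PosSemidef (Matrix.of fun a b => gmet (N + 1) a b
      + (-1 / mkp u v) * (u a * v b + v a * u b)) := by
  refine Matrix.PosSemidef.of_dotProduct_mulVec_nonneg ?_ ?_
  · ext a b
    simp only [Matrix.conjTranspose_apply, star_trivial, Matrix.of_apply]
    have : gmet (N + 1) b a = gmet (N + 1) a b := by
      unfold gmet; by_cases h : a = b
      · subst h; rfl
      · rw [if_neg h, if_neg (Ne.symm h)]
    rw [this]; ring
  · intro x
    set w : Fin (N + 1) → ℝ := Fin.cons (- x 0) (fun i => x i.succ) with hw
    have k := one_form u v w hu hv hu0 hv0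
    have e1 : mkp w w = ∑ a, ∑ b, gmet (N + 1) a b * x a * x b := by
      change _ = mkp x x
      rw [mkp_eq, mkp_eq]; simp [hw]
    have e2 : ∀ y, mkp y w = ∑ a, y a * x a := by
      intro y; rw [mkp_eq, Fin.sum_univ_succ]; simp [hw]
    have e : (star x ⬝ᵥ Matrix.mulVec (Matrix.of fun a b => gmet (N + 1) a b
        + (-1 / mkp u v) * (u a * v b + v a * u b)) x)
        = mkp w w + (-1 / mkp u v) * (2 * mkp u w * mkp v w) := by
      have e3 : 2 * mkp u w * mkp v w
          = ∑ a, ∑ b, (u a * v b + v a * u b) * x a * x b := by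
        have : 2 * mkp u w * mkp v w = mkp u w * mkp v w + mkp v w * mkp u w := by ring
        rw [this, e2, e2, Finset.sum_mul_sum, Finset.sum_mul_sum]
        simp only [← Finset.sum_add_distrib]
        refine Finset.sum_congr rfl fun a _ => Finset.sum_congr rfl fun b _ => by ring
      rw [e3, e1]
      simp only [dotProduct, Matrix.mulVec, Finset.mul_sum, ← Finset.sum_add_distrib,
        star_trivial, Pi.star_apply, Matrix.of_apply]
      refine Finset.sum_congr rfl fun a _ => Finset.sum_congr rfl fun b _ => by ring
    rw [e]
    have : mkp w w + (-1 / mkp u v) * (2 * mkp u w * mkp v w)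
        = (2 * mkp u w * mkp v w - mkp u v * mkp w w) / (- mkp u v) := by
      have := hneg.ne
      field_simp
      ring
    rw [this]
    exact div_nonneg k (by linarith)

theorem mkp_neg {N : ℕ} (u v : Fin (N + 1) → ℝ) (hu : mkp u u < 0) (hv : mkp v v ≤ 0)
    (hu0 : 0 < u 0) (hv0 : 0 < v 0) : mkp u v < 0 := by
  rw [mkp_eq] at *
  have hU : 0 ≤ ∑ i : Fin N, u i.succ * u i.succ := Finset.sum_nonneg fun i _ => mul_self_nonneg _
  have hs := Real.sq_sqrt hU
  have c := cs (fun i : Fin N => u i.succ) (fun i : Fin N => v i.succ)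
    (Real.sqrt (∑ i : Fin N, u i.succ * u i.succ)) (v 0) (Real.sqrt_nonneg _) hv0.le
    (by rw [hs]) (by nlinarith)
  have hlt : Real.sqrt (∑ i : Fin N, u i.succ * u i.succ) < u 0 := by
    rw [Real.sqrt_lt' hu0]; nlinarith
  have := (abs_le.mp c).2
  nlinarith

/-- The energy functional. -/
theorem energy_eq {N q : ℕ} (hp : 0 < q + 1) (S : (Fin (q + 1) → Fin (N + 1)) → ℝ)
    (u v : Fin (N + 1) → ℝ) :
    ∑ lam, ∑ mu, seT (N + 1) (q + 1) hp S lam mu * u lam * v mu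
      = (1 / (q.factorial : ℝ)) * cQ (gmet (N + 1)) q (ins u (toL S)) (ins v (toL S))
        - (1 / (2 * ((q + 1).factorial : ℝ))) * mkp u v
          * cQ (gmet (N + 1)) (q + 1) (toL S) (toL S) := by
  have hfull : fullContract (N + 1) (q + 1) S
      = cQ (gmet (N + 1)) (q + 1) (toL S) (toL S) := by
    rw [cQ_eq_sum]; simp only [toL_ofFn, fullContract]
  rw [cQ_ins_ins, ← hfull]
  simp only [seT, part_eq, mkp, Finset.mul_sum, Finset.sum_mul, ← Finset.sum_sub_distrib,
    Nat.add_sub_cancel]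
  refine Finset.sum_congr rfl fun a _ => Finset.sum_congr rfl fun b _ => by ring

theorem energy_pos {N q : ℕ} (hp : 0 < q + 1) (S : (Fin (q + 1) → Fin (N + 1)) → ℝ)
    (hS : IsPForm (N + 1) (q + 1) S)
    (u v : Fin (N + 1) → ℝ) (hu : mkp u u < 0) (hv : mkp v v ≤ 0)
    (hu0 : 0 < u 0) (hv0 : 0 < v 0) :
    0 ≤ ∑ lam, ∑ mu, seT (N + 1) (q + 1) hp S lam mu * u lam * v mu := by
  have hneg := mkp_neg u v hu hv hu0 hv0
  have hA := toL_anti S hS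
  rw [energy_eq]
  set F := toL S
  have p1 := cQ_nonneg _ (psd u v hu.le hv hu0.le hv0.le hneg) (q + 1) F
  rw [cQ_expand _ _ _ _ _ _ _ hA hA] at p1
  have hB : Anti (ins u (ins v F)) := (hA.ins v).ins u
  have p2 := cQ_nonneg _ (psd u u hu.le hu.le hu0.le hu0.le hu) (q - 1) (ins u (ins v F))
  rw [cQ_expand _ _ _ _ _ _ _ hB hB, ins_self (hA.ins v)] at p2
  have z : ins u (fun _ => (0 : ℝ)) = fun _ => (0 : ℝ) := by funext l; simp [ins]
  simp only [z, cQ_zero_left, add_zero, mul_zero, sub_zero] at p2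
  have sym : cQ (gmet (N + 1)) q (ins v F) (ins u F) = cQ (gmet (N + 1)) q (ins u F) (ins v F) := by
    rw [cQ_ins_ins, cQ_ins_ins, Finset.sum_comm]
    refine Finset.sum_congr rfl fun a _ => Finset.sum_congr rfl fun b _ => ?_
    have : cQ (gmet (N + 1)) q (fun l => F (b :: l)) (fun l => F (a :: l))
        = cQ (gmet (N + 1)) q (fun l => F (a :: l)) (fun l => F (b :: l)) := by
      rw [cQ_eq_sum, cQ_eq_sum, Finset.sum_comm]
      refine Finset.sum_congr rfl fun ρ _ => Finset.sum_congr rfl fun τ _ => ?_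
      have : ∀ i, gmet (N + 1) (τ i) (ρ i) = gmet (N + 1) (ρ i) (τ i) := by
        intro i
        unfold gmet; by_cases h : ρ i = τ i
        · rw [h]
        · rw [if_neg h, if_neg (Ne.symm h)]
      simp only [this]; ring
    rw [this]; ring
  have e3 : q + 1 - 2 = q - 1 := by omega
  rw [e3, Nat.add_sub_cancel, sym] at p1
  push_cast at p1
  have p3 : 0 ≤ (-1 / mkp u v) ^ 2 * ((q : ℝ) + 1) * ((q : ℝ) + 1 - 1)
      * cQ (gmet (N + 1)) (q - 1) (ins u (ins v F)) (ins u (ins v F)) := by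
    have : (0 : ℝ) ≤ (q : ℝ) + 1 - 1 := by simp
    positivity
  set A := cQ (gmet (N + 1)) q (ins u F) (ins v F)
  set B := cQ (gmet (N + 1)) (q + 1) F F
  have p4 : 0 ≤ B + (-1 / mkp u v) * ((q : ℝ) + 1) * (A + A) := by linarith
  have hf : (0 : ℝ) < q.factorial := by exact_mod_cast q.factorial_pos
  have : 1 / (q.factorial : ℝ) * A - 1 / (2 * ((q + 1).factorial : ℝ)) * mkp u v * B
      = (- mkp u v) / (2 * ((q + 1).factorial : ℝ))
        * (B + (-1 / mkp u v) * ((q : ℝ) + 1) * (A + A)) := by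
    rw [Nat.factorial_succ]
    push_cast
    have := hneg.ne
    have h2 : (q : ℝ) + 1 ≠ 0 := by positivity
    field_simp
    ring
  rw [this]
  exact mul_nonneg (div_nonneg (by linarith) (by positivity)) p4

/-- the dominant super-energy property for simple `p`-forms. -/
theorem dominant_superenergy_pform
    (n p : ℕ) (hp : 1 ≤ p) (hpn : p ≤ n)
    (S : (Fin p → Fin n) → ℝ) (hS : IsPForm n p S)
    (u v : Fin n → ℝ)
    (huc : minkSq n u ≤ 0) (huf : 0 < u ⟨0, by omega⟩)
    (hvc : minkSq n v ≤ 0) (hvf : 0 < v ⟨0, by omega⟩) :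
    0 ≤ ∑ lam : Fin n, ∑ mu : Fin n, seT n p hp S lam mu * u lam * v mu := by
  obtain ⟨q, rfl⟩ : ∃ q, p = q + 1 := ⟨p - 1, by omega⟩
  obtain ⟨N, rfl⟩ : ∃ N, n = N + 1 := ⟨n - 1, by omega⟩
  change mkp u u ≤ 0 at huc
  change mkp v v ≤ 0 at hvc
  change 0 < u 0 at huf
  change 0 < v 0 at hvf
  set e : Fin (N + 1) → ℝ := Fin.cons 1 (fun _ => 0) with he
  have key : ∀ ε : ℝ, 0 < ε →
      0 ≤ (∑ lam, ∑ mu, seT (N + 1) (q + 1) hp S lam mu * u lam * v mu)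
        + ε * ∑ lam, ∑ mu, seT (N + 1) (q + 1) hp S lam mu * e lam * v mu := by
    intro ε hε
    have h := energy_pos hp S hS (fun i => u i + ε * e i) v
      (by rw [mkp_eq] at huc ⊢; simp [he]; nlinarith) hvc (by simp [he]; linarith) hvf
    convert h using 1
    simp only [Finset.mul_sum, ← Finset.sum_add_distrib]
    refine Finset.sum_congr rfl fun a _ => Finset.sum_congr rfl fun b _ => by ring
  set X := ∑ lam, ∑ mu, seT (N + 1) (q + 1) hp S lam mu * u lam * v mu
  set Y := ∑ lam, ∑ mu, seT (N + 1) (q + 1) hp S lam mu * e lam * v mu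
  by_contra hX
  push Not at hX
  have hk := key (-X / (2 * (|Y| + 1))) (div_pos (by linarith) (by positivity))
  have hY : -X / (2 * (|Y| + 1)) * Y ≤ -X / 2 := by
    rw [div_mul_eq_mul_div, div_le_div_iff₀ (by positivity) (by norm_num)]
    nlinarith [le_abs_self Y]
  linarith
end
end

section
/- Let n ≥ 2, 1 ≤ p ≤ n−1, and c₁, c₂ ∈ ℝ. For a p-form Σ define T{Σ;c₁,c₂}_{λμ} = ((c₁+c₂)/(p−1)!)·Σ_{λρ₂…ρ_p}Σ_μ{}^{ρ₂…ρ_p} − (c₂/p!)·η_{λμ}·Σ_{ρ₁…ρ_p}Σ^{ρ₁…ρ_p}. Then T{Σ;c₁,c₂}_{λμ} u^λ v^μ ≥ 0 holds for every p-form Σ and all future-pointing causal vectors u, v if and only if c₁ = c₂ and c₁ ≥ 0; that is, among these two-parameter combinations the only tensors satisfying the dominant super-energy property for all p-forms are the non-negative multiples of the basic super-energy tensor. -/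
open Finset

noncomputable section

/-- The two-parameter tensor `T{Σ;c₁,c₂}_{λμ}`. -/
def seT2 (n p : ℕ) (hp : 0 < p) (c₁ c₂ : ℝ) (S : (Fin p → Fin n) → ℝ) (lam mu : Fin n) : ℝ :=
  ((c₁ + c₂) / ((p - 1).factorial : ℝ)) * partContract n p hp S lam mu
    - (c₂ / (p.factorial : ℝ)) * gmet n lam mu * fullContract n p S

/-- sign of a coordinate -/
def ee (n : ℕ) (μ : Fin n) : ℝ := if (μ : ℕ) = 0 then -1 else 1

lemma ee_sq (n : ℕ) (μ : Fin n) : ee n μ * ee n μ = 1 := by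
  unfold ee; split_ifs <;> norm_num

lemma gmet_eq (n : ℕ) (μ ν : Fin n) : gmet n μ ν = if μ = ν then ee n μ else 0 := rfl

/-- Minkowski bilinear form -/
def BB (n : ℕ) (x y : Fin n → ℝ) : ℝ := ∑ μ, ee n μ * x μ * y μ

lemma gsum_eq (n : ℕ) (x y : Fin n → ℝ) :
    ∑ μ, ∑ ν, gmet n μ ν * x μ * y ν = BB n x y := by
  simp [gmet_eq, BB, ite_mul]

lemma minkSq_eq (n : ℕ) (x : Fin n → ℝ) : minkSq n x = BB n x x := gsum_eq n x x

lemma BB_comm (n : ℕ) (x y : Fin n → ℝ) : BB n x y = BB n y x := by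
  unfold BB; refine sum_congr rfl fun i _ => by ring

lemma BB_add_left (n : ℕ) (x y z : Fin n → ℝ) : BB n (x + y) z = BB n x z + BB n y z := by
  simp only [BB, Pi.add_apply, ← sum_add_distrib]; refine sum_congr rfl fun i _ => by ring

lemma BB_smul_left (n : ℕ) (a : ℝ) (x z : Fin n → ℝ) : BB n (a • x) z = a * BB n x z := by
  simp only [BB, Pi.smul_apply, smul_eq_mul, mul_sum]; refine sum_congr rfl fun i _ => by ring

lemma BB_add_right (n : ℕ) (x y z : Fin n → ℝ) : BB n z (x + y) = BB n z x + BB n z y := by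
  rw [BB_comm, BB_add_left, BB_comm n x, BB_comm n y]

lemma BB_smul_right (n : ℕ) (a : ℝ) (x z : Fin n → ℝ) : BB n z (a • x) = a * BB n z x := by
  rw [BB_comm, BB_smul_left, BB_comm n x]

/-- reflection -/
def refl' (n : ℕ) (d x : Fin n → ℝ) : Fin n → ℝ := x + (-(2 * BB n x d / BB n d d)) • d

lemma BB_refl (n : ℕ) (d x y : Fin n → ℝ) : BB n (refl' n d x) (refl' n d y) = BB n x y := by
  simp only [refl', BB_add_left, BB_add_right, BB_smul_left, BB_smul_right]
  rw [BB_comm n d y]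
  by_cases h : BB n d d = 0
  · simp [h]
  · field_simp; ring

lemma refl_refl (n : ℕ) (d x : Fin n → ℝ) : refl' n d (refl' n d x) = x := by
  have : BB n (refl' n d x) d / BB n d d = - (BB n x d / BB n d d) := by
    simp only [refl', BB_add_left, BB_smul_left]
    by_cases h : BB n d d = 0
    · simp [h]
    · field_simp; ring
  have h1 : refl' n d (refl' n d x) =
    refl' n d x + (-(2 * (BB n (refl' n d x) d / BB n d d))) • d := by
      rw [refl', mul_div_assoc]
  rw [h1, this, refl', mul_div_assoc]
  ext i; simp

lemma refl_map (n : ℕ) (a b : Fin n → ℝ) (h : BB n a a = BB n b b)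
    (h0 : BB n (b + (-1 : ℝ) • a) (b + (-1 : ℝ) • a) = 0 → a = b) :
    refl' n (b + (-1 : ℝ) • a) a = b := by
  by_cases hd : BB n (b + (-1 : ℝ) • a) (b + (-1 : ℝ) • a) = 0
  · rw [refl', hd, ← h0 hd]; simp
  · have : 2 * BB n a (b + (-1 : ℝ) • a) / BB n (b + (-1 : ℝ) • a) (b + (-1 : ℝ) • a) = -1 := by
      rw [div_eq_iff hd]
      simp only [BB_add_left, BB_add_right, BB_smul_left, BB_smul_right]
      rw [BB_comm n b a]; linarith
    rw [refl', this]; ext i; simp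

/-- general contraction -/
def CC (n p : ℕ) (M : Fin p → Fin n → Fin n → ℝ) (S : (Fin p → Fin n) → ℝ) : ℝ :=
  ∑ ρ : Fin p → Fin n, ∑ τ : Fin p → Fin n, S ρ * S τ * ∏ i, M i (ρ i) (τ i)

/-- pullback -/
def pull (n p : ℕ) (L : Fin n → Fin n → ℝ) (S : (Fin p → Fin n) → ℝ) (ρ : Fin p → Fin n) : ℝ :=
  ∑ τ : Fin p → Fin n, (∏ i, L (ρ i) (τ i)) * S τ

lemma pull_form (n p : ℕ) (L : Fin n → Fin n → ℝ) (S : (Fin p → Fin n) → ℝ)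
    (hS : IsPForm n p S) : IsPForm n p (pull n p L S) := by
  intro σ μ
  unfold pull
  rw [mul_sum, ← (Equiv.arrowCongr σ.symm (Equiv.refl (Fin n))).sum_comp]
  refine sum_congr rfl fun τ _ => ?_
  have : (Equiv.arrowCongr σ.symm (Equiv.refl (Fin n))) τ = τ ∘ σ := by ext; simp
  rw [this, hS σ τ]
  have h2 : ∏ i, L ((μ ∘ σ) i) ((τ ∘ σ) i) = ∏ i, L (μ i) (τ i) :=
    Equiv.prod_comp σ (fun i => L (μ i) (τ i))
  rw [h2]; ring

lemma CC_pull (n p : ℕ) (L : Fin n → Fin n → ℝ) (M : Fin p → Fin n → Fin n → ℝ)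
    (S : (Fin p → Fin n) → ℝ) :
    CC n p M (pull n p L S) =
      CC n p (fun i r t => ∑ a, ∑ b, L a r * M i a b * L b t) S := by
  have e1 : ∀ ρ' τ' : Fin p → Fin n, ∏ i, ∑ a, ∑ b, L a (ρ' i) * M i a b * L b (τ' i) =
     ∑ ρ : Fin p → Fin n, ∑ τ : Fin p → Fin n,
       (∏ i, L (ρ i) (ρ' i)) * (∏ i, M i (ρ i) (τ i)) * (∏ i, L (τ i) (τ' i)) := by
    intro ρ' τ'
    rw [Fintype.prod_sum]
    refine sum_congr rfl fun ρ _ => ?_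
    rw [Fintype.prod_sum]
    refine sum_congr rfl fun τ _ => ?_
    rw [prod_mul_distrib, prod_mul_distrib]
  unfold CC
  simp only [e1]
  simp only [pull, sum_mul_sum]
  simp only [mul_sum, sum_mul]
  rw [show (∑ ρ' : Fin p → Fin n, ∑ τ' : Fin p → Fin n, ∑ ρ : Fin p → Fin n, ∑ τ : Fin p → Fin n,
      S ρ' * S τ' * ((∏ i, L (ρ i) (ρ' i)) * (∏ i, M i (ρ i) (τ i)) * (∏ i, L (τ i) (τ' i)))) =
      ∑ x : (Fin p → Fin n) × (Fin p → Fin n), ∑ y : (Fin p → Fin n) × (Fin p → Fin n), 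
       S x.1 * S x.2 * ((∏ i, L (y.1 i) (x.1 i)) * (∏ i, M i (y.1 i) (y.2 i)) * (∏ i, L (y.2 i) (x.2 i))) by simp only [Fintype.sum_prod_type]]
  conv_rhs => rw [sum_comm]
  simp only [Fintype.sum_prod_type]
  refine sum_congr rfl fun ρ _ => sum_congr rfl fun τ _ => sum_congr rfl fun ρ' _ =>
    sum_congr rfl fun τ' _ => by ring

lemma full_CC (n p : ℕ) (S : (Fin p → Fin n) → ℝ) :
    fullContract n p S = CC n p (fun _ => gmet n) S := rfl

/-- matrices for the partial contraction -/
def PM (n p : ℕ) (hp : 0 < p) (u v : Fin n → ℝ) (i : Fin p) (a b : Fin n) : ℝ :=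
  if i = ⟨0, hp⟩ then u a * v b else gmet n a b

lemma part_CC (n p : ℕ) (hp : 0 < p) (S : (Fin p → Fin n) → ℝ) (u v : Fin n → ℝ) :
    ∑ l, ∑ m, partContract n p hp S l m * u l * v m = CC n p (PM n p hp u v) S := by
  have e : ∀ ρ τ : Fin p → Fin n, ∏ i, PM n p hp u v i (ρ i) (τ i) =
      u (ρ ⟨0, hp⟩) * v (τ ⟨0, hp⟩) *
      ∏ i ∈ Finset.univ.filter (fun i => i ≠ (⟨0, hp⟩ : Fin p)), gmet n (ρ i) (τ i) := by
    intro ρ τ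
    rw [← Finset.mul_prod_erase univ _ (mem_univ (⟨0, hp⟩ : Fin p)), filter_ne']
    congr 1
    refine prod_congr rfl fun i hi => ?_
    simp [PM, (mem_erase.1 hi).1]
  unfold CC partContract
  simp only [e, sum_mul]
  rw [show (∑ l : Fin n, ∑ m : Fin n, ∑ ρ : Fin p → Fin n, ∑ τ : Fin p → Fin n,
     (if ρ ⟨0, hp⟩ = l ∧ τ ⟨0, hp⟩ = m then
      S ρ * S τ *
        ∏ i ∈ Finset.univ.filter (fun i => i ≠ (⟨0, hp⟩ : Fin p)), gmet n (ρ i) (τ i)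
    else 0) * u l * v m) = ∑ x : Fin n × Fin n, ∑ y : (Fin p → Fin n) × (Fin p → Fin n), 
     (if y.1 ⟨0, hp⟩ = x.1 ∧ y.2 ⟨0, hp⟩ = x.2 then
      S y.1 * S y.2 *
        ∏ i ∈ Finset.univ.filter (fun i => i ≠ (⟨0, hp⟩ : Fin p)), gmet n (y.1 i) (y.2 i)
    else 0) * u x.1 * v x.2 by simp only [Fintype.sum_prod_type]]
  rw [sum_comm]
  simp only [Fintype.sum_prod_type]
  refine sum_congr rfl fun ρ _ => sum_congr rfl fun τ _ => ?_
  rw [sum_eq_single (ρ ⟨0, hp⟩), sum_eq_single (τ ⟨0, hp⟩)]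
  · simp; ring
  · intro b _ hb; simp [hb.symm]
  · simp
  · intro b _ hb; simp [hb.symm]
  · simp

/-- The evaluated basic tensor -/
def WW (n p : ℕ) (hp : 0 < p) (S : (Fin p → Fin n) → ℝ) (u v : Fin n → ℝ) : ℝ :=
  ∑ l, ∑ m, seT n p hp S l m * u l * v m

lemma WW_eq (n p : ℕ) (hp : 0 < p) (S : (Fin p → Fin n) → ℝ) (u v : Fin n → ℝ) :
    WW n p hp S u v = (1 / ((p - 1).factorial : ℝ)) * CC n p (PM n p hp u v) S
    - (1 / (2 * (p.factorial : ℝ))) * BB n u v * fullContract n p S := by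
  rw [← part_CC, ← gsum_eq]
  simp only [WW, seT, mul_sum, sum_mul, ← sum_sub_distrib]
  refine sum_congr rfl fun ρ _ => sum_congr rfl fun τ _ => by ring

/-- reflection matrix -/
def RL (n : ℕ) (d : Fin n → ℝ) (a b : Fin n) : ℝ :=
  (if a = b then 1 else 0) - 2 / BB n d d * ee n a * d a * d b

lemma RL_vec (n : ℕ) (d x : Fin n → ℝ) (r : Fin n) : ∑ a, RL n d a r * x a = refl' n d x r := by
  simp only [RL, refl', sub_mul, sum_sub_distrib, ite_mul, one_mul, zero_mul, sum_ite_eq',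
    mem_univ, if_true, Pi.add_apply, Pi.smul_apply, smul_eq_mul]
  rw [sub_eq_add_neg]; congr 1
  rw [neg_mul, mul_div_right_comm]
  rw [BB.eq_1 n x d, mul_sum, sum_mul]
  congr 1
  refine sum_congr rfl fun i _ => by ring

lemma RL_g (n : ℕ) (d : Fin n → ℝ) (r t : Fin n) :
    ∑ a, ∑ b, RL n d a r * gmet n a b * RL n d b t = gmet n r t := by
  have h0 : ∀ a, ∑ b, RL n d a r * gmet n a b * RL n d b t =
      RL n d a r * (ee n a * RL n d a t) := by
    intro a; simp [gmet_eq, mul_assoc]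
  simp only [h0]
  rw [RL_vec n d (fun a => ee n a * RL n d a t) r]
  have h2 : BB n (fun a => ee n a * RL n d a t) d = refl' n d d t := by
    rw [← RL_vec]
    unfold BB
    refine sum_congr rfl fun i _ => ?_
    linear_combination (RL n d i t * d i) * ee_sq n i
  rw [refl', h2]
  simp only [refl', Pi.add_apply, Pi.smul_apply, smul_eq_mul, RL, gmet_eq]
  by_cases h : BB n d d = 0
  · simp [h]
  · have := ee_sq n r
    by_cases hr : r = t
    · simp only [hr, if_true] at this ⊢
      field_simp
      linear_combination (-2 * d t ^ 2) * this
    · simp only [hr, if_false]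
      field_simp
      linear_combination (-2 * d t * d r) * this

lemma WW_refl (n p : ℕ) (hp : 0 < p) (S : (Fin p → Fin n) → ℝ) (hS : IsPForm n p S)
    (d : Fin n → ℝ) : ∃ S', IsPForm n p S' ∧ ∀ x y,
      WW n p hp S (refl' n d x) (refl' n d y) = WW n p hp S' x y := by
  refine ⟨pull n p (RL n d) S, pull_form _ _ _ _ hS, fun x y => ?_⟩
  rw [WW_eq, WW_eq, full_CC, full_CC, CC_pull, CC_pull, BB_refl]
  simp only [RL_g]
  congr 3
  ext i r t
  by_cases hi : i = ⟨0, hp⟩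
  · simp only [PM, hi, if_true]
    rw [← RL_vec, ← RL_vec, sum_mul_sum]
    refine sum_congr rfl fun ρ _ => sum_congr rfl fun τ _ => by ring
  · simp only [PM, hi, if_false, RL_g]

lemma full_diag (n p : ℕ) (S : (Fin p → Fin n) → ℝ) :
    fullContract n p S = ∑ ρ, S ρ ^ 2 * ∏ i, ee n (ρ i) := by
  unfold fullContract
  refine sum_congr rfl fun ρ _ => ?_
  rw [sum_eq_single ρ]
  · simp only [gmet_eq, if_true]; ring
  · intro τ _ hτ
    obtain ⟨i, hi⟩ := Function.ne_iff.1 hτ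
    rw [prod_eq_zero (mem_univ i), mul_zero]
    simp [gmet_eq, hi.symm]
  · simp

lemma part_diag (n p : ℕ) (hp : 0 < p) (S : (Fin p → Fin n) → ℝ) (l m : Fin n) :
    partContract n p hp S l m = ∑ ρ : Fin p → Fin n, if ρ ⟨0, hp⟩ = l then
      S ρ * S (Function.update ρ ⟨0, hp⟩ m) *
        ∏ i ∈ Finset.univ.filter (fun i => i ≠ (⟨0, hp⟩ : Fin p)), ee n (ρ i) else 0 := by
  unfold partContract
  refine sum_congr rfl fun ρ _ => ?_
  rw [sum_eq_single (Function.update ρ ⟨0, hp⟩ m)]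
  · by_cases h : ρ ⟨0, hp⟩ = l
    · simp only [h, Function.update_self, and_self, if_true]
      congr 1
      refine prod_congr rfl fun i hi => ?_
      rw [Function.update_of_ne (mem_filter.1 hi).2]; simp [gmet_eq]
    · simp [h]
  · intro τ _ hτ
    split_ifs with h
    · obtain ⟨i, hi⟩ := Function.ne_iff.1 hτ
      have hi0 : i ≠ ⟨0, hp⟩ := by
        rintro rfl
        simp [h.2] at hi
      rw [Function.update_of_ne hi0] at hi
      rw [prod_eq_zero (i := i) (by simpa using hi0), mul_zero]
      simp [gmet_eq, hi.symm]
    · rfl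
  · simp

/-- number of occurrences -/
def cnt (n p : ℕ) (ρ : Fin p → Fin n) (j : Fin n) : ℝ := ∑ i, if ρ i = j then 1 else 0

lemma cnt_sum (n p : ℕ) (hp : 0 < p) (f : (Fin p → Fin n) → ℝ)
    (hf : ∀ (σ : Equiv.Perm (Fin p)) ρ, f (ρ ∘ σ) = f ρ) (j : Fin n) :
    (p : ℝ) * ∑ ρ, (if ρ ⟨0, hp⟩ = j then f ρ else 0) = ∑ ρ, cnt n p ρ j * f ρ := by
  simp only [cnt, sum_mul]
  rw [sum_comm]
  have : ∀ i : Fin p, ∑ ρ : Fin p → Fin n, (if ρ i = j then 1 else 0) * f ρ =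
      ∑ ρ : Fin p → Fin n, (if ρ ⟨0, hp⟩ = j then f ρ else 0) := by
    intro i
    rw [← (Equiv.arrowCongr (Equiv.swap i ⟨0, hp⟩) (Equiv.refl (Fin n))).sum_comp]
    refine sum_congr rfl fun τ _ => ?_
    have : (Equiv.arrowCongr (Equiv.swap i ⟨0, hp⟩) (Equiv.refl (Fin n))) τ
       = τ ∘ Equiv.swap i ⟨0, hp⟩ := by ext; simp
    rw [this, hf]; simp
  simp only [this]; simp

lemma cnt_mem (n p : ℕ) (ρ : Fin p → Fin n) (h : Function.Injective ρ) (i : Fin p) :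
    cnt n p ρ (ρ i) = 1 := by
  simp [cnt, h.eq_iff]

lemma cnt_not_mem (n p : ℕ) (ρ : Fin p → Fin n) (j : Fin n) (h : ∀ i, ρ i ≠ j) :
    cnt n p ρ j = 0 := by
  simp [cnt, h]

lemma cnt_nonneg (n p : ℕ) (ρ : Fin p → Fin n) (j : Fin n) : 0 ≤ cnt n p ρ j :=
  sum_nonneg fun i _ => by split_ifs <;> norm_num

lemma cnt_le (n p : ℕ) (ρ : Fin p → Fin n) (h : Function.Injective ρ) (j : Fin n) :
    cnt n p ρ j ≤ 1 := by
  by_cases hj : ∃ i, ρ i = j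
  · obtain ⟨i, rfl⟩ := hj; exact (cnt_mem n p ρ h i).le
  · push Not at hj; rw [cnt_not_mem n p ρ j hj]; norm_num

lemma form_zero (n p : ℕ) (S : (Fin p → Fin n) → ℝ) (hS : IsPForm n p S) (ρ : Fin p → Fin n)
    (h : ¬ Function.Injective ρ) : S ρ = 0 := by
  simp only [Function.Injective, not_forall] at h
  obtain ⟨i, j, hij, hne⟩ := h
  have := hS (Equiv.swap i j) ρ
  have h2 : ρ ∘ Equiv.swap i j = ρ := by
    ext k
    simp only [Function.comp]
    by_cases hk : k = i
    · simp [hk, hij]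
    · by_cases hk' : k = j
      · simp [hk', hij]
      · rw [Equiv.swap_apply_of_ne_of_ne hk hk']
  rw [h2, Equiv.Perm.sign_swap hne] at this
  norm_num at this; linarith

lemma form_sq (n p : ℕ) (S : (Fin p → Fin n) → ℝ) (hS : IsPForm n p S)
    (σ : Equiv.Perm (Fin p)) (ρ : Fin p → Fin n) : S (ρ ∘ σ) ^ 2 = S ρ ^ 2 := by
  rw [hS, mul_pow]
  rcases Int.units_eq_one_or (Equiv.Perm.sign σ) with h | h <;> simp [h]

lemma ee_of_ne (n : ℕ) (z : Fin n) (hz : (z : ℕ) = 0) (a : Fin n) (h : a ≠ z) : ee n a = 1 := by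
  unfold ee
  rw [if_neg]
  intro h'; apply h; ext; omega

lemma prod_ee (n p : ℕ) (z : Fin n) (hz : (z : ℕ) = 0) (ρ : Fin p → Fin n)
    (h : Function.Injective ρ) : ∏ i, ee n (ρ i) = 1 - 2 * cnt n p ρ z := by
  by_cases hj : ∃ i, ρ i = z
  · obtain ⟨i, hi⟩ := hj
    rw [← hi, cnt_mem n p ρ h i, prod_eq_single i]
    · rw [hi]; simp [ee, hz]; norm_num
    · intro b _ hb
      apply ee_of_ne n z hz
      rw [← hi]; exact fun h' => hb (h h')
    · simp
  · push Not at hj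
    rw [cnt_not_mem n p ρ z hj, prod_eq_one]
    · simp
    · intro i _; exact ee_of_ne n z hz _ (hj i)

/-- `T₀₀ ≥ |T₀₁|`. -/
lemma key0 (n p : ℕ) (hp : 0 < p) (S : (Fin p → Fin n) → ℝ) (hS : IsPForm n p S)
    (z o : Fin n) (hz : (z : ℕ) = 0) (ho : (o : ℕ) = 1) :
    |seT n p hp S z o| ≤ seT n p hp S z z := by
  set N := ∑ ρ, S ρ ^ 2 with hN
  set X := ∑ ρ : Fin p → Fin n, (if ρ ⟨0, hp⟩ = z then S ρ ^ 2 else 0) with hX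
  set Z := ∑ ρ : Fin p → Fin n, (if ρ ⟨0, hp⟩ = o then
    (if ∃ i, ρ i = z then 0 else S ρ ^ 2) else 0) with hZ
  have hzo : o ≠ z := by intro h; rw [h] at ho; omega
  have hrest : ∀ ρ : Fin p → Fin n, ρ ⟨0, hp⟩ = z → Function.Injective ρ →
      ∏ i ∈ Finset.univ.filter (fun i => i ≠ (⟨0, hp⟩ : Fin p)), ee n (ρ i) = 1 := by
    intro ρ h hi
    refine prod_eq_one fun i hi' => ?_
    apply ee_of_ne n z hz
    rw [← h]; exact fun h' => (mem_filter.1 hi').2 (hi h')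
  have hpX : (p : ℝ) * X = ∑ ρ, cnt n p ρ z * S ρ ^ 2 :=
    cnt_sum n p hp _ (form_sq n p S hS) z
  have hF : fullContract n p S = N - 2 * (p * X) := by
    rw [full_diag, hpX, hN, mul_sum, ← sum_sub_distrib]
    refine sum_congr rfl fun ρ _ => ?_
    by_cases h : Function.Injective ρ
    · rw [prod_ee n p z hz ρ h]; ring
    · rw [form_zero n p S hS ρ h]; ring
  have hP : partContract n p hp S z z = X := by
    rw [part_diag]
    refine sum_congr rfl fun ρ _ => ?_
    by_cases h : ρ ⟨0, hp⟩ = z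
    · simp only [h, if_true]
      rw [← h, Function.update_eq_self]
      by_cases hi : Function.Injective ρ
      · rw [hrest ρ h hi]; ring
      · rw [form_zero n p S hS ρ hi]; ring
    · simp [h]
  have hpZ : (p : ℝ) * Z ≤ N - p * X := by
    rw [hpX, hZ, cnt_sum n p hp (fun ρ => if ∃ i, ρ i = z then 0 else S ρ ^ 2), hN,
      ← sum_sub_distrib]
    · refine sum_le_sum fun ρ _ => ?_
      by_cases h : Function.Injective ρ
      · split_ifs with h1
        · obtain ⟨i, rfl⟩ := h1
          rw [cnt_mem n p ρ h]; simp
        · push Not at h1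
          rw [cnt_not_mem n p ρ z h1]
          nlinarith [cnt_le n p ρ h o, sq_nonneg (S ρ)]
      · rw [form_zero n p S hS ρ h]; simp
    · intro σ ρ
      have : (∃ i, (ρ ∘ σ) i = z) ↔ ∃ i, ρ i = z := by
        constructor
        · rintro ⟨i, hi⟩; exact ⟨_, hi⟩
        · rintro ⟨i, hi⟩; exact ⟨σ.symm i, by simpa using hi⟩
      simp only [this, form_sq n p S hS]
  have hZ' : Z = ∑ ρ : Fin p → Fin n, (if ρ ⟨0, hp⟩ = z then
      (if ∃ i, Function.update ρ ⟨0, hp⟩ o i = z then 0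
        else S (Function.update ρ ⟨0, hp⟩ o) ^ 2) else 0) := by
    rw [hZ, ← sum_filter, ← sum_filter]
    refine sum_nbij' (fun ρ => Function.update ρ ⟨0, hp⟩ z)
      (fun ρ => Function.update ρ ⟨0, hp⟩ o) ?_ ?_ ?_ ?_ ?_
    · intro ρ h; simp
    · intro ρ h; simp
    · intro ρ h; simp [← (mem_filter.1 h).2]
    · intro ρ h; simp [← (mem_filter.1 h).2]
    · intro ρ h
      have : Function.update (Function.update ρ ⟨0, hp⟩ z) ⟨0, hp⟩ o = ρ := by
        simp [← (mem_filter.1 h).2]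
      simp only [this]
  have hO : |partContract n p hp S z o| ≤ (X + Z) / 2 := by
    rw [part_diag, hX, hZ', ← sum_add_distrib, sum_div]
    refine (abs_sum_le_sum_abs _ _).trans (sum_le_sum fun ρ _ => ?_)
    by_cases h : ρ ⟨0, hp⟩ = z
    · simp only [h, if_true]
      by_cases hi : Function.Injective ρ
      · rw [hrest ρ h hi, mul_one, if_neg]
        · rw [abs_le]; constructor <;>
          nlinarith [sq_nonneg (S ρ - S (Function.update ρ ⟨0, hp⟩ o)),
            sq_nonneg (S ρ + S (Function.update ρ ⟨0, hp⟩ o))]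
        · rintro ⟨i, hi'⟩
          by_cases h0 : i = ⟨0, hp⟩
          · rw [h0] at hi'; simp at hi'; exact hzo hi'
          · rw [Function.update_of_ne h0, ← h] at hi'; exact h0 (hi hi')
      · rw [form_zero n p S hS ρ hi]; simp
        split_ifs <;> positivity
    · simp [h]
  have hzz : seT n p hp S z z = N / (2 * p.factorial) := by
    unfold seT
    rw [hP, hF]
    obtain ⟨q, rfl⟩ : ∃ q, p = q + 1 := ⟨p - 1, by omega⟩
    have : ((q + 1).factorial : ℝ) = (q + 1) * q.factorial := by
      rw [Nat.factorial_succ]; push_cast; ring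
    have h1 : (q.factorial : ℝ) ≠ 0 := by positivity
    simp only [gmet_eq, ee, hz, if_true, Nat.add_sub_cancel, this]
    push_cast
    field_simp
    ring
  have hzo' : seT n p hp S z o = 1 / ((p - 1).factorial : ℝ) * partContract n p hp S z o := by
    simp [seT, gmet_eq, hzo.symm]
  rw [hzz, hzo', abs_mul, abs_of_pos (by positivity)]
  obtain ⟨q, rfl⟩ : ∃ q, p = q + 1 := ⟨p - 1, by omega⟩
  have : ((q + 1).factorial : ℝ) = (q + 1) * q.factorial := by
    rw [Nat.factorial_succ]; push_cast; ring
  have h1 : (0 : ℝ) < q.factorial := by positivity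
  rw [this, Nat.add_sub_cancel, one_div, inv_mul_le_iff₀ h1]
  refine hO.trans ?_
  push_cast at hpZ
  rw [show (q.factorial : ℝ) * (N / (2 * ((q + 1) * q.factorial))) = N / (2 * (q + 1)) by
    field_simp]
  rw [div_le_div_iff₀ (by norm_num) (by positivity)]
  nlinarith

/-- basis vector -/
def ev (n : ℕ) (j : Fin n) : Fin n → ℝ := fun i => if i = j then 1 else 0

lemma WW_add_left (n p : ℕ) (hp : 0 < p) (S : (Fin p → Fin n) → ℝ) (x y w : Fin n → ℝ) :
    WW n p hp S (x + y) w = WW n p hp S x w + WW n p hp S y w := by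
  simp only [WW, Pi.add_apply, ← sum_add_distrib]
  refine sum_congr rfl fun ρ _ => sum_congr rfl fun τ _ => by ring

lemma WW_add_right (n p : ℕ) (hp : 0 < p) (S : (Fin p → Fin n) → ℝ) (x y w : Fin n → ℝ) :
    WW n p hp S w (x + y) = WW n p hp S w x + WW n p hp S w y := by
  simp only [WW, Pi.add_apply, ← sum_add_distrib]
  refine sum_congr rfl fun ρ _ => sum_congr rfl fun τ _ => by ring

lemma WW_smul_left (n p : ℕ) (hp : 0 < p) (S : (Fin p → Fin n) → ℝ) (a : ℝ) (x w : Fin n → ℝ) :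
    WW n p hp S (a • x) w = a * WW n p hp S x w := by
  simp only [WW, Pi.smul_apply, smul_eq_mul, mul_sum]
  refine sum_congr rfl fun ρ _ => sum_congr rfl fun τ _ => by ring

lemma WW_smul_right (n p : ℕ) (hp : 0 < p) (S : (Fin p → Fin n) → ℝ) (a : ℝ) (x w : Fin n → ℝ) :
    WW n p hp S w (a • x) = a * WW n p hp S w x := by
  simp only [WW, Pi.smul_apply, smul_eq_mul, mul_sum]
  refine sum_congr rfl fun ρ _ => sum_congr rfl fun τ _ => by ring

lemma WW_ev (n p : ℕ) (hp : 0 < p) (S : (Fin p → Fin n) → ℝ) (i j : Fin n) :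
    WW n p hp S (ev n i) (ev n j) = seT n p hp S i j := by
  simp [WW, ev]

lemma BB_ev (n : ℕ) (x : Fin n → ℝ) (j : Fin n) : BB n (ev n j) x = ee n j * x j := by
  simp [BB, ev]

lemma BB_ev' (n : ℕ) (x : Fin n → ℝ) (j : Fin n) : BB n x (ev n j) = ee n j * x j := by
  rw [BB_comm, BB_ev]

/-- time-space splitting -/
lemma BB_split (n : ℕ) (z : Fin n) (hz : (z : ℕ) = 0) (x y : Fin n → ℝ) :
    BB n x y = - (x z * y z) + ∑ i ∈ univ.erase z, x i * y i := by
  unfold BB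
  rw [← add_sum_erase univ _ (mem_univ z)]
  congr 1
  · simp [ee, hz]
  · refine sum_congr rfl fun i hi => ?_
    rw [ee_of_ne n z hz i (mem_erase.1 hi).1, one_mul]

lemma key1 (n p : ℕ) (hp : 0 < p) (S : (Fin p → Fin n) → ℝ) (hS : IsPForm n p S)
    (z o : Fin n) (hz : (z : ℕ) = 0) (ho : (o : ℕ) = 1) (s r : ℝ) (hsr : |r| ≤ s) :
    0 ≤ WW n p hp S (ev n z) (s • ev n z + r • ev n o) := by
  rw [WW_add_right, WW_smul_right, WW_smul_right, WW_ev, WW_ev]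
  have h := key0 n p hp S hS z o hz ho
  have h1 : |r * seT n p hp S z o| ≤ s * seT n p hp S z z := by
    rw [abs_mul]; exact mul_le_mul hsr h (abs_nonneg _) ((abs_nonneg _).trans hsr)
  linarith [neg_abs_le (r * seT n p hp S z o)]

lemma key2 (n p : ℕ) (hp : 0 < p) (S : (Fin p → Fin n) → ℝ) (hS : IsPForm n p S)
    (z o : Fin n) (hz : (z : ℕ) = 0) (ho : (o : ℕ) = 1) (y : Fin n → ℝ)
    (hy : BB n y y ≤ 0) (hy0 : 0 ≤ y z) :
    0 ≤ WW n p hp S (ev n z) y := by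
  have hzo : o ≠ z := by intro h; rw [h] at ho; omega
  have hez : ee n z = -1 := by simp [ee, hz]
  have heo : ee n o = 1 := by simp [ee, ho]
  set Q := ∑ i ∈ univ.erase z, y i * y i with hQ
  have hQ0 : 0 ≤ Q := sum_nonneg fun i _ => mul_self_nonneg _
  have hyy := BB_split n z hz y y
  set r := Real.sqrt Q with hr
  have hr2 : r * r = Q := Real.mul_self_sqrt hQ0
  have hr0 : 0 ≤ r := Real.sqrt_nonneg _
  set a := y z • ev n z + r • ev n o with ha
  have haz : a z = y z := by simp [ha, ev, hzo.symm]
  have haa : BB n a a = BB n y y := by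
    rw [hyy, ← hQ]
    simp only [ha, BB_add_left, BB_add_right, BB_smul_left, BB_smul_right, BB_ev, hez, heo]
    simp [ev, hzo, hzo.symm]
    linarith
  set d := y + (-1 : ℝ) • a with hd
  have hdz : d z = 0 := by simp [hd, haz]
  have hmap : refl' n d a = y := by
    apply refl_map n a y haa
    intro h
    rw [← hd, BB_split n z hz, hdz, mul_zero, neg_zero, zero_add,
      sum_eq_zero_iff_of_nonneg (fun i _ => mul_self_nonneg _)] at h
    ext i
    by_cases hi : i = z
    · rw [hi, haz]
    · have := mul_self_eq_zero.1 (h i (by simp [hi]))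
      simp [hd] at this; linarith
  have hmap0 : refl' n d (ev n z) = ev n z := by
    simp [refl', BB_ev, hdz]
  obtain ⟨S', hS', hW⟩ := WW_refl n p hp S hS d
  rw [← hmap, ← hmap0, hW]
  apply key1 n p hp S' hS' z o hz ho
  rw [abs_of_nonneg hr0]
  apply abs_le_of_sq_le_sq' _ hy0 |>.2
  nlinarith

lemma BB_nonpos (n : ℕ) (z : Fin n) (hz : (z : ℕ) = 0) (u v : Fin n → ℝ)
    (hu : BB n u u ≤ 0) (hu0 : 0 ≤ u z) (hv : BB n v v ≤ 0) (hv0 : 0 ≤ v z) :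
    BB n u v ≤ 0 := by
  rw [BB_split n z hz] at *
  have h := sum_mul_sq_le_sq_mul_sq (univ.erase z) u v
  simp only [pow_two (u _), pow_two (v _)] at h
  have hv1 : 0 ≤ ∑ i ∈ univ.erase z, v i * v i := sum_nonneg fun i _ => mul_self_nonneg _
  have h2 : (∑ i ∈ univ.erase z, u i * v i) ^ 2 ≤ (u z * v z) ^ 2 := by
    refine h.trans ?_
    calc _ ≤ (u z * u z) * (v z * v z) :=
          mul_le_mul (by linarith) (by linarith) hv1 (mul_self_nonneg _)
      _ = _ := by ring
  linarith [(abs_le_of_sq_le_sq' h2 (mul_nonneg hu0 hv0)).2]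

lemma key3 (n p : ℕ) (hp : 0 < p) (S : (Fin p → Fin n) → ℝ) (hS : IsPForm n p S)
    (z o : Fin n) (hz : (z : ℕ) = 0) (ho : (o : ℕ) = 1) (u v : Fin n → ℝ)
    (hu : BB n u u < 0) (hu0 : 0 < u z) (hv : BB n v v ≤ 0) (hv0 : 0 < v z) :
    0 ≤ WW n p hp S u v := by
  have hez : ee n z = -1 := by simp [ee, hz]
  set m := Real.sqrt (- BB n u u) with hm
  have hm2 : m * m = - BB n u u := Real.mul_self_sqrt (by linarith)
  have hm0 : 0 < m := Real.sqrt_pos.2 (by linarith)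
  set a := m • ev n z with ha
  have haz : a z = m := by simp [ha, ev]
  have haa : BB n a a = BB n u u := by
    simp only [ha, BB_smul_left, BB_smul_right, BB_ev, hez]
    simp [ev]; linarith
  set d := u + (-1 : ℝ) • a with hd
  have hmap : refl' n d a = u := by
    apply refl_map n a u haa
    intro h
    have h1 : BB n a u = - (m * u z) := by
      rw [ha, BB_smul_left, BB_ev, hez]; ring
    simp only [BB_add_left, BB_add_right, BB_smul_left, BB_smul_right] at h
    rw [BB_comm n u a, h1, haa] at h
    have h2 : m * (u z - m) = 0 := by linarith
    have h3 : u z = m := by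
      rcases mul_eq_zero.1 h2 with h | h
      · exact absurd h hm0.ne'
      · linarith
    have h4 := BB_split n z hz u u
    have h5 : ∑ i ∈ univ.erase z, u i * u i = 0 := by rw [h3] at h4; linarith
    rw [sum_eq_zero_iff_of_nonneg (fun i _ => mul_self_nonneg _)] at h5
    ext i
    by_cases hi : i = z
    · rw [hi, haz, h3]
    · rw [mul_self_eq_zero.1 (h5 i (by simp [hi]))]
      simp [ha, ev, hi]
  obtain ⟨S', hS', hW⟩ := WW_refl n p hp S hS d
  have hBv : BB n (refl' n d v) (refl' n d v) ≤ 0 := by rw [BB_refl]; exact hv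
  have hB : BB n a (refl' n d v) = BB n u v := by
    rw [← BB_refl n d a, hmap, refl_refl]
  have hn := BB_nonpos n z hz u v hu.le hu0.le hv hv0.le
  rw [← hB, ha, BB_smul_left, BB_ev, hez] at hn
  have hv' : 0 ≤ refl' n d v z := by
    by_contra hc
    push Not at hc
    nlinarith
  rw [← refl_refl n d v, ← hmap, hW, ha, WW_smul_left]
  exact mul_nonneg hm0.le (key2 n p hp S' hS' z o hz ho _ hBv hv')

lemma key4 (n p : ℕ) (hp : 0 < p) (S : (Fin p → Fin n) → ℝ) (hS : IsPForm n p S)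
    (z o : Fin n) (hz : (z : ℕ) = 0) (ho : (o : ℕ) = 1) (u v : Fin n → ℝ)
    (hu : BB n u u ≤ 0) (hu0 : 0 < u z) (hv : BB n v v ≤ 0) (hv0 : 0 < v z) :
    0 ≤ WW n p hp S u v := by
  have hez : ee n z = -1 := by simp [ee, hz]
  have h : ∀ t : ℝ, 0 < t → 0 ≤ WW n p hp S u v + t * WW n p hp S (ev n z) v := by
    intro t ht
    rw [← WW_smul_left, ← WW_add_left]
    apply key3 n p hp S hS z o hz ho _ _ _ _ hv hv0
    · simp only [BB_add_left, BB_add_right, BB_smul_left, BB_smul_right, BB_ev, BB_ev', hez]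
      simp only [ev, if_true, Pi.add_apply, Pi.smul_apply, smul_eq_mul]
      nlinarith [mul_pos ht hu0, mul_pos ht ht]
    · simp [ev]; linarith
  by_contra hc
  push Not at hc
  have h1 := h 1 one_pos
  have hb : 0 < WW n p hp S (ev n z) v := by linarith
  have h2 := h (- WW n p hp S u v / (2 * WW n p hp S (ev n z) v)) (by
    apply div_pos <;> linarith)
  have h3 : - WW n p hp S u v / (2 * WW n p hp S (ev n z) v) * WW n p hp S (ev n z) v =
    - WW n p hp S u v / 2 := by field_simp
  linarith

/-- basis form -/
def bform (n p : ℕ) (s : Fin p → Fin n) (ρ : Fin p → Fin n) : ℝ :=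
  Matrix.det (Matrix.of fun i k => if ρ i = s k then (1 : ℝ) else 0)

lemma bform_form (n p : ℕ) (s : Fin p → Fin n) : IsPForm n p (bform n p s) := by
  intro σ μ
  exact Matrix.det_permute σ (Matrix.of fun i k => if μ i = s k then (1 : ℝ) else 0)

lemma bform_self (n p : ℕ) (s : Fin p → Fin n) (hs : Function.Injective s) :
    bform n p s s = 1 := by
  unfold bform
  rw [← Matrix.det_one (n := Fin p)]
  congr 1
  ext i k
  simp [Matrix.one_apply, hs.eq_iff]

lemma bform_supp (n p : ℕ) (s ρ : Fin p → Fin n) (h : bform n p s ρ ≠ 0) :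
    ∃ σ : Equiv.Perm (Fin p), ρ ∘ σ = s := by
  unfold bform at h
  rw [Matrix.det_apply] at h
  obtain ⟨σ, _, hσ⟩ := exists_ne_zero_of_sum_ne_zero h
  refine ⟨σ, ?_⟩
  ext1 i
  by_contra hc
  apply hσ
  rw [prod_eq_zero (mem_univ i)]
  · simp
  · simpa using hc

lemma bform_full (n p : ℕ) (s : Fin p → Fin n) :
    fullContract n p (bform n p s) = (∏ i, ee n (s i)) * ∑ ρ, bform n p s ρ ^ 2 := by
  rw [full_diag, mul_sum]
  refine sum_congr rfl fun ρ _ => ?_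
  by_cases h : bform n p s ρ = 0
  · simp [h]
  · obtain ⟨σ, rfl⟩ := bform_supp n p s ρ h
    have := Equiv.prod_comp σ (fun i => ee n (ρ i))
    simp only [Function.comp]
    rw [this]; ring

lemma cnt_comp (n p : ℕ) (ρ : Fin p → Fin n) (σ : Equiv.Perm (Fin p)) (j : Fin n) :
    cnt n p (ρ ∘ σ) j = cnt n p ρ j :=
  Equiv.sum_comp σ (fun i => if ρ i = j then (1 : ℝ) else 0)

lemma bform_part (n p : ℕ) (hp : 0 < p) (s : Fin p → Fin n) (j : Fin n) :
    (p : ℝ) * partContract n p hp (bform n p s) j j =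
      ee n j * (∏ i, ee n (s i)) * cnt n p s j * ∑ ρ, bform n p s ρ ^ 2 := by
  have h1 : partContract n p hp (bform n p s) j j = ee n j * (∏ i, ee n (s i)) *
      ∑ ρ : Fin p → Fin n, (if ρ ⟨0, hp⟩ = j then bform n p s ρ ^ 2 else 0) := by
    rw [part_diag, mul_sum]
    refine sum_congr rfl fun ρ _ => ?_
    by_cases h0 : ρ ⟨0, hp⟩ = j
    · simp only [h0, if_true]
      rw [← h0, Function.update_eq_self]
      by_cases h : bform n p s ρ = 0
      · simp [h]
      · obtain ⟨σ, rfl⟩ := bform_supp n p s ρ h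
        have := Equiv.prod_comp σ (fun i => ee n (ρ i))
        simp only [Function.comp]
        rw [this, ← Finset.mul_prod_erase univ _ (mem_univ (⟨0, hp⟩ : Fin p)), filter_ne']
        generalize ∏ i ∈ univ.erase (⟨0, hp⟩ : Fin p), ee n (ρ i) = P
        have := ee_sq n (ρ ⟨0, hp⟩)
        generalize bform n p (ρ ∘ σ) ρ = b
        linear_combination (- b ^ 2 * P) * this
    · simp [h0]
  rw [h1, mul_left_comm, cnt_sum n p hp _ (form_sq n p _ (bform_form n p s)), mul_assoc (_ * _)]
  congr 1
  rw [mul_sum]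
  refine sum_congr rfl fun ρ _ => ?_
  by_cases h : bform n p s ρ = 0
  · simp [h]
  · obtain ⟨σ, rfl⟩ := bform_supp n p s ρ h
    rw [cnt_comp]

lemma part_symm (n p : ℕ) (hp : 0 < p) (S : (Fin p → Fin n) → ℝ) (l m : Fin n) :
    partContract n p hp S l m = partContract n p hp S m l := by
  unfold partContract
  rw [sum_comm]
  refine sum_congr rfl fun ρ _ => sum_congr rfl fun τ _ => ?_
  have : ∀ a b, gmet n a b = gmet n b a := by
    intro a b
    simp only [gmet_eq]
    by_cases h : a = b
    · simp [h]
    · simp [h, Ne.symm h]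
  simp only [this (τ _), and_comm (a := τ _ = _), mul_comm (S τ)]

/-- test of the dominance on a basis form -/
lemma test (n p : ℕ) (hp : 0 < p) (c₁ c₂ : ℝ) (s : Fin p → Fin n) (hs : Function.Injective s)
    (z j : Fin n) (hz : (z : ℕ) = 0) (hj : j ≠ z) (t : ℝ)
    (h : 0 ≤ ∑ l : Fin n, ∑ m : Fin n, seT2 n p hp c₁ c₂ (bform n p s) l m *
      (ev n z + t • ev n j) l * (ev n z + (-t) • ev n j) m) :
    0 ≤ (∏ i, ee n (s i)) *
      (-(c₁ + c₂) * (cnt n p s z + t ^ 2 * cnt n p s j) + (1 + t ^ 2) * c₂) := by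
  have hez : ee n z = -1 := by simp [ee, hz]
  have hej : ee n j = 1 := ee_of_ne n z hz j hj
  have hsum : ∀ T : Fin n → Fin n → ℝ, ∑ l : Fin n, ∑ m : Fin n, T l m *
      (ev n z + t • ev n j) l * (ev n z + (-t) • ev n j) m =
      T z z - t * T z j + t * T j z - t ^ 2 * T j j := by
    intro T
    simp only [ev, Pi.add_apply, Pi.smul_apply, smul_eq_mul, mul_add, add_mul, sum_add_distrib,
      mul_ite, ite_mul, mul_one, mul_zero, zero_mul, sum_ite_eq', mem_univ, if_true]
    ring
  rw [hsum] at h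
  simp only [seT2, part_symm n p hp _ j z, gmet_eq, hj, hj.symm, if_true, if_false, hez, hej,
    bform_full] at h
  have hz' := bform_part n p hp s z
  have hj' := bform_part n p hp s j
  rw [hez] at hz'
  rw [hej] at hj'
  set N := ∑ ρ, bform n p s ρ ^ 2 with hN
  have hN0 : 0 < N := by
    refine sum_pos' (fun i _ => sq_nonneg _) ⟨s, mem_univ _, ?_⟩
    rw [bform_self n p s hs]; norm_num
  obtain ⟨q, rfl⟩ : ∃ q, p = q + 1 := ⟨p - 1, by omega⟩
  have hf : ((q + 1).factorial : ℝ) = (q + 1) * q.factorial := by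
    rw [Nat.factorial_succ]; push_cast; ring
  have hq : (0 : ℝ) < q.factorial := by positivity
  push_cast at hz' hj'
  rw [hf, Nat.add_sub_cancel] at h
  have hq1 : (0 : ℝ) < (q : ℝ) + 1 := by positivity
  rw [mul_comm, ← eq_div_iff hq1.ne'] at hz' hj'
  rw [hz', hj'] at h
  have hk : 0 < N / ((q + 1) * q.factorial) := by positivity
  refine nonneg_of_mul_nonneg_right (a := N / ((q + 1) * q.factorial)) ?_ hk
  refine h.trans_eq ?_
  field_simp
  ring

/-- among the two-parameter combinations, only the non-negative multiples of
the basic super-energy tensor satisfy the dominant super-energy property for all `p`-forms. -/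
theorem dominant_property_iff_basic
    (n p : ℕ) (hn : 2 ≤ n) (hp : 1 ≤ p) (hpn : p ≤ n - 1) (c₁ c₂ : ℝ) :
    (∀ S : (Fin p → Fin n) → ℝ, IsPForm n p S →
      ∀ u v : Fin n → ℝ,
        minkSq n u ≤ 0 → 0 < u ⟨0, by omega⟩ →
        minkSq n v ≤ 0 → 0 < v ⟨0, by omega⟩ →
        0 ≤ ∑ lam : Fin n, ∑ mu : Fin n, seT2 n p hp c₁ c₂ S lam mu * u lam * v mu)
    ↔ (c₁ = c₂ ∧ 0 ≤ c₁) := by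
  have hp' : 0 < p := hp
  set z : Fin n := ⟨0, by omega⟩ with hzdef
  set o : Fin n := ⟨1, by omega⟩ with hodef
  have hz : (z : ℕ) = 0 := rfl
  have ho : (o : ℕ) = 1 := rfl
  constructor
  · intro H
    have main : ∀ s : Fin p → Fin n, Function.Injective s → ∀ j : Fin n, j ≠ z → ∀ t : ℝ,
        t ^ 2 ≤ 1 → 0 ≤ (∏ i, ee n (s i)) *
      (-(c₁ + c₂) * (cnt n p s z + t ^ 2 * cnt n p s j) + (1 + t ^ 2) * c₂) := by
      intro s hs j hj t ht
      have hej : ee n j = 1 := ee_of_ne n z hz j hj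
      have hez : ee n z = -1 := by simp [ee, hz]
      have hc : ∀ r : ℝ, r ^ 2 ≤ 1 → minkSq n (ev n z + r • ev n j) ≤ 0 := by
        intro r hr
        rw [minkSq_eq]
        simp only [BB_add_left, BB_add_right, BB_smul_left, BB_smul_right, BB_ev, hez, hej]
        simp only [ev, if_true, hj, hj.symm, if_false]
        linarith
      have hc0 : ∀ r : ℝ, 0 < (ev n z + r • ev n j) z := by
        intro r; simp [ev, hj.symm]
      exact test n p hp c₁ c₂ s hs z j hz hj t
        (H _ (bform_form n p s) _ _ (hc t ht) (hc0 t) (hc (-t) (by simpa using ht)) (hc0 _))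
    -- electric form
    have hA := main (fun i => ⟨i, by omega⟩) (fun a b h => by simpa [Fin.ext_iff] using h)
      ⟨p, by omega⟩ (by rw [hzdef, Ne, Fin.ext_iff]; simp; omega) 1 (by norm_num)
    have hAi : Function.Injective (fun i : Fin p => (⟨i, by omega⟩ : Fin n)) :=
      fun a b h => by simpa [Fin.ext_iff] using h
    have hAz := cnt_mem n p _ hAi ⟨0, hp⟩
    have hAp := cnt_not_mem n p (fun i : Fin p => (⟨i, by omega⟩ : Fin n)) ⟨p, by omega⟩
      (fun i => by have := i.2; rw [Ne, Fin.ext_iff]; simp; omega)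
    have hAe := prod_ee n p z hz _ hAi
    simp only [← hzdef] at hAz
    rw [hAe, hAz, hAp] at hA
    -- magnetic form
    have hBi : Function.Injective (fun i : Fin p => (⟨i + 1, by omega⟩ : Fin n)) :=
      fun a b h => by simpa [Fin.ext_iff] using h
    have hoz : o ≠ z := by rw [hzdef, hodef, Ne, Fin.ext_iff]; simp
    have hBz := cnt_not_mem n p (fun i : Fin p => (⟨i + 1, by omega⟩ : Fin n)) z
      (fun i => by rw [hzdef, Ne, Fin.ext_iff]; simp)
    have hBo := cnt_mem n p _ hBi ⟨0, hp⟩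
    simp only [Nat.zero_add, ← hodef] at hBo
    have hBe := prod_ee n p z hz _ hBi
    have hB1 := main _ hBi o hoz 1 (by norm_num)
    have hB0 := main _ hBi o hoz 0 (by norm_num)
    rw [hBe, hBz, hBo] at hB1 hB0
    constructor <;> linarith
  · rintro ⟨rfl, hc⟩ S hS u v hu hu0 hv hv0
    rw [minkSq_eq] at hu hv
    have h := key4 n p hp S hS z o hz ho u v hu hu0 hv hv0
    have h2 : ∑ lam : Fin n, ∑ mu : Fin n, seT2 n p hp c₁ c₁ S lam mu * u lam * v mu =
        2 * c₁ * WW n p hp S u v := by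
      simp only [WW, mul_sum]
      refine sum_congr rfl fun l _ => sum_congr rfl fun m _ => ?_
      simp only [seT, seT2]
      have : (p.factorial : ℝ) ≠ 0 := by positivity
      have : ((p - 1).factorial : ℝ) ≠ 0 := by positivity
      field_simp
      ring
    rw [h2]
    positivity
end
end

section
/- Let 1 ≤ p ≤ n. For every p-form Σ on n-dimensional Minkowski space and every timelike vector u, the super-energy density W_Σ(u) = T{Σ}_{λμ} u^λ u^μ is non-negative; moreover, if W_Σ(u) = 0 for some timelike u, then Σ = 0 (and hence the whole tensor T{Σ} vanishes). -/
open Finset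

noncomputable section

/-- Real inequality behind the positive definiteness of `η + 2 u ⊗ u / N`. -/
theorem aux_real (a U V b w : ℝ) (hN : 0 < a ^ 2 - U) (hU : 0 ≤ U) (hV : 0 ≤ V)
    (hb : b ^ 2 ≤ U * V) (hne : w ≠ 0 ∨ 0 < V) :
    0 < (a ^ 2 - U) * (V - w ^ 2) + 2 * (a * w + b) ^ 2 := by
  rcases hU.eq_or_lt with h0 | h0
  · subst h0
    have hb0 : b = 0 := by nlinarith [sq_nonneg b]
    subst hb0
    have ha : 0 < a ^ 2 := by linarith
    have : 0 < V + w ^ 2 := by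
      rcases hne with h | h
      · positivity
      · positivity
    nlinarith [mul_pos ha this]
  · have key : U * ((a ^ 2 - U) * (V - w ^ 2) + 2 * (a * w + b) ^ 2)
        = (a ^ 2 - U) * (U * V - b ^ 2) + (a * b + U * w) ^ 2 + U * (b + a * w) ^ 2 := by ring
    have h1 : 0 ≤ (a ^ 2 - U) * (U * V - b ^ 2) := mul_nonneg hN.le (by linarith)
    have h2 := sq_nonneg (a * b + U * w)
    have h3 : 0 ≤ U * (b + a * w) ^ 2 := by positivity
    by_contra hcon
    push Not at hcon
    have h4 : U * ((a ^ 2 - U) * (V - w ^ 2) + 2 * (a * w + b) ^ 2) ≤ 0 :=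
      mul_nonpos_of_nonneg_of_nonpos hU hcon
    have e1 : (a ^ 2 - U) * (U * V - b ^ 2) = 0 := by linarith
    have e2 : (a * b + U * w) ^ 2 = 0 := by linarith
    have e3 : U * (b + a * w) ^ 2 = 0 := by linarith
    have e2' : a * b + U * w = 0 := by simpa using e2
    have e3' : b + a * w = 0 := by
      rcases mul_eq_zero.1 e3 with h | h
      · exact absurd h h0.ne'
      · simpa using h
    have e1' : U * V - b ^ 2 = 0 := (mul_eq_zero.1 e1).resolve_left hN.ne'
    have hw : (a ^ 2 - U) * w = 0 := by linear_combination a * e3' - e2'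
    have hw0 : w = 0 := (mul_eq_zero.1 hw).resolve_left hN.ne'
    have hb0 : b = 0 := by rw [hw0] at e3'; linarith
    have hUV : U * V = 0 := by rw [hb0] at e1'; linarith
    have hV0 : V = 0 := (mul_eq_zero.1 hUV).resolve_left h0.ne'
    rcases hne with h | h
    · exact h hw0
    · linarith

theorem gmet_quad (m : ℕ) (v : Fin (m + 1) → ℝ) :
    ∑ μ, ∑ ν, gmet (m + 1) μ ν * v μ * v ν = (∑ i : Fin m, v i.succ ^ 2) - v 0 ^ 2 := by
  have : ∀ μ, ∑ ν, gmet (m + 1) μ ν * v μ * v ν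
      = (if (μ : ℕ) = 0 then -1 else 1) * v μ ^ 2 := by
    intro μ
    simp only [gmet, ite_mul, zero_mul, Finset.sum_ite_eq, Finset.mem_univ, if_true]
    split_ifs <;> ring
  simp only [this, Fin.sum_univ_succ]
  simp
  ring

theorem hmet_pos (m : ℕ) (u v : Fin (m + 1) → ℝ) (hu : minkSq (m + 1) u < 0) (hv : v ≠ 0) :
    0 < ∑ μ, ∑ ν, (gmet (m + 1) μ ν + 2 / (-minkSq (m + 1) u) * (u μ * u ν)) * v μ * v ν := by
  have e : ∑ μ, ∑ ν, (gmet (m + 1) μ ν + 2 / (-minkSq (m + 1) u) * (u μ * u ν)) * v μ * v ν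
      = ((∑ i : Fin m, v i.succ ^ 2) - v 0 ^ 2)
        + 2 / (-minkSq (m + 1) u) * (∑ μ, u μ * v μ) ^ 2 := by
    rw [← gmet_quad, pow_two, Finset.sum_mul_sum, Finset.mul_sum, ← Finset.sum_add_distrib]
    refine Finset.sum_congr rfl fun μ _ => ?_
    rw [Finset.mul_sum, ← Finset.sum_add_distrib]
    refine Finset.sum_congr rfl fun ν _ => ?_
    ring
  have hN : minkSq (m + 1) u = (∑ i : Fin m, u i.succ ^ 2) - u 0 ^ 2 := gmet_quad m u
  have hV : 0 ≤ ∑ i : Fin m, v i.succ ^ 2 := Finset.sum_nonneg fun _ _ => sq_nonneg _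
  have hne : v 0 ≠ 0 ∨ 0 < ∑ i : Fin m, v i.succ ^ 2 := by
    by_contra hcon
    push Not at hcon
    have hz : ∑ i : Fin m, v i.succ ^ 2 = 0 := le_antisymm hcon.2 hV
    rw [Finset.sum_eq_zero_iff_of_nonneg (fun _ _ => sq_nonneg _)] at hz
    apply hv
    funext i
    refine Fin.cases hcon.1 (fun j => ?_) i
    simpa using hz j (Finset.mem_univ _)
  have := aux_real (u 0) (∑ i : Fin m, u i.succ ^ 2) (∑ i : Fin m, v i.succ ^ 2)
    (∑ i : Fin m, u i.succ * v i.succ) (v 0) (by linarith)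
    (Finset.sum_nonneg fun _ _ => sq_nonneg _) hV
    (Finset.sum_mul_sq_le_sq_mul_sq _ _ _) hne
  rw [e, Fin.sum_univ_succ]
  have hN0 : 0 < -minkSq (m + 1) u := by linarith
  have h5 : -minkSq (m + 1) u = u 0 ^ 2 - ∑ i : Fin m, u i.succ ^ 2 := by rw [hN]; ring
  rw [h5] at hN0 ⊢
  have h6 := div_pos this hN0
  have hN1 := hN0.ne'
  generalize u 0 ^ 2 - ∑ i : Fin m, u i.succ ^ 2 = N at *
  generalize (∑ i : Fin m, v i.succ ^ 2) = V at *
  have h7 : V - v 0 ^ 2 + 2 / N * (u 0 * v 0 + ∑ i : Fin m, u i.succ * v i.succ) ^ 2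
      = (N * (V - v 0 ^ 2) + 2 * (u 0 * v 0 + ∑ i : Fin m, u i.succ * v i.succ) ^ 2) / N := by
    rw [eq_div_iff hN1, add_mul]
    field_simp
  rw [h7]
  exact h6

theorem hmet_factor (n : ℕ) (hn : 0 < n) (u : Fin n → ℝ) (hu : minkSq n u < 0) :
    ∃ B C : Matrix (Fin n) (Fin n) ℝ, C * B = 1 ∧
      ∀ μ ν, gmet n μ ν + 2 / (-minkSq n u) * (u μ * u ν) = ∑ k, B k μ * B k ν := by
  obtain ⟨m, rfl⟩ : ∃ m, n = m + 1 := ⟨n - 1, by omega⟩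
  set H : Matrix (Fin (m + 1)) (Fin (m + 1)) ℝ :=
    Matrix.of fun μ ν => gmet (m + 1) μ ν + 2 / (-minkSq (m + 1) u) * (u μ * u ν) with hH
  have hpd : H.PosDef := by
    refine Matrix.PosDef.of_dotProduct_mulVec_pos ?_ ?_
    · ext μ ν
      by_cases h : μ = ν
      · subst h; simp
      · have h' : ¬ ν = μ := fun e => h e.symm
        simp [hH, Matrix.conjTranspose_apply, gmet, h, h', mul_comm]
    · intro v hv
      refine lt_of_lt_of_eq (hmet_pos m u v hu hv) ?_
      simp only [dotProduct, Matrix.mulVec, hH, Matrix.of_apply, Finset.mul_sum, Pi.star_apply,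
        star_trivial]
      refine Finset.sum_congr rfl fun μ _ => Finset.sum_congr rfl fun ν _ => ?_
      ring
  open scoped MatrixOrder in
  obtain ⟨B, hB⟩ := CStarAlgebra.nonneg_iff_eq_star_mul_self.mp hpd.posSemidef.nonneg
  have hdet : IsUnit B.det := by
    have h1 := hpd.det_pos
    rw [hB, Matrix.det_mul] at h1
    exact isUnit_iff_ne_zero.2 (right_ne_zero_of_mul h1.ne')
  refine ⟨B, B⁻¹, Matrix.nonsing_inv_mul _ hdet, fun μ ν => ?_⟩
  have := congrFun (congrFun hB μ) ν
  simpa [hH, Matrix.mul_apply, Matrix.star_apply] using this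

/-- The quadratic form of a factored metric on tensors is a sum of squares. -/
theorem quad_factor (n p : ℕ) (S : (Fin p → Fin n) → ℝ) (h : Fin n → Fin n → ℝ)
    (B : Matrix (Fin n) (Fin n) ℝ) (hB : ∀ μ ν, h μ ν = ∑ k, B k μ * B k ν) :
    ∑ ρ : Fin p → Fin n, ∑ τ : Fin p → Fin n, S ρ * S τ * ∏ i, h (ρ i) (τ i)
      = ∑ κ : Fin p → Fin n, (∑ ρ : Fin p → Fin n, S ρ * ∏ i, B (κ i) (ρ i)) ^ 2 := by
  have e : ∀ ρ τ : Fin p → Fin n, ∏ i, h (ρ i) (τ i)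
      = ∑ κ : Fin p → Fin n, (∏ i, B (κ i) (ρ i)) * ∏ i, B (κ i) (τ i) := by
    intro ρ τ
    simp only [hB, Finset.prod_univ_sum, Fintype.piFinset_univ, Finset.prod_mul_distrib]
  simp only [e, pow_two, Finset.sum_mul_sum]
  simp only [Finset.mul_sum]
  calc _ = ∑ ρ : Fin p → Fin n, ∑ κ : Fin p → Fin n, ∑ τ : Fin p → Fin n,
      S ρ * S τ * ((∏ i, B (κ i) (ρ i)) * ∏ i, B (κ i) (τ i)) :=
        Finset.sum_congr rfl fun ρ _ => Finset.sum_comm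
    _ = _ := by
      rw [Finset.sum_comm]
      refine Finset.sum_congr rfl fun κ _ => Finset.sum_congr rfl fun ρ _ =>
        Finset.sum_congr rfl fun τ _ => ?_
      ring

theorem transform_inj (n p : ℕ) (S : (Fin p → Fin n) → ℝ)
    (B C : Matrix (Fin n) (Fin n) ℝ) (hCB : C * B = 1)
    (h0 : ∀ κ : Fin p → Fin n, ∑ ρ : Fin p → Fin n, S ρ * ∏ i, B (κ i) (ρ i) = 0) : S = 0 := by
  funext σ
  have h1 : ∑ κ : Fin p → Fin n, (∏ i, C (σ i) (κ i)) *
      ∑ ρ : Fin p → Fin n, S ρ * ∏ i, B (κ i) (ρ i) = 0 := by simp [h0]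
  simp only [Finset.mul_sum] at h1
  rw [Finset.sum_comm] at h1
  have h2 : ∀ ρ : Fin p → Fin n, ∑ κ : Fin p → Fin n, (∏ i, C (σ i) (κ i)) *
      (S ρ * ∏ i, B (κ i) (ρ i)) = if σ = ρ then S ρ else 0 := by
    intro ρ
    have : ∏ i, (∑ k, C (σ i) k * B k (ρ i)) = if σ = ρ then (1 : ℝ) else 0 := by
      have h3 : ∀ i, ∑ k, C (σ i) k * B k (ρ i) = if σ i = ρ i then (1 : ℝ) else 0 := by
        intro i
        rw [← Matrix.mul_apply, hCB, Matrix.one_apply]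
      simp only [h3]
      by_cases hσ : σ = ρ
      · subst hσ; simp
      · rw [if_neg hσ]
        obtain ⟨i, hi⟩ := Function.ne_iff.1 hσ
        exact Finset.prod_eq_zero (Finset.mem_univ i) (if_neg hi)
    rw [Finset.prod_univ_sum, Fintype.piFinset_univ] at this
    simp only [Finset.prod_mul_distrib] at this
    calc _ = S ρ * ∑ κ : Fin p → Fin n, (∏ i, C (σ i) (κ i)) * ∏ i, B (κ i) (ρ i) := by
          rw [Finset.mul_sum]
          exact Finset.sum_congr rfl fun κ _ => by ring
      _ = _ := by rw [this]; simp
  simpa [h2] using h1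

/-- The term of the expansion with `u ⊗ u` in the slots `t` and `η` in the others. -/
def termG (n p : ℕ) (S : (Fin p → Fin n) → ℝ) (u : Fin n → ℝ) (t : Finset (Fin p)) : ℝ :=
  ∑ ρ : Fin p → Fin n, ∑ τ : Fin p → Fin n, S ρ * S τ *
    ∏ k, if k ∈ t then u (ρ k) * u (τ k) else gmet n (ρ k) (τ k)

/-- Reindexing of tensor indices by a permutation of the slots. -/
def slotEquiv (n p : ℕ) (σ : Equiv.Perm (Fin p)) : (Fin p → Fin n) ≃ (Fin p → Fin n) :=
  Equiv.arrowCongr σ⁻¹ (Equiv.refl _)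

theorem slotEquiv_apply (n p : ℕ) (σ : Equiv.Perm (Fin p)) (ρ : Fin p → Fin n) :
    slotEquiv n p σ ρ = ρ ∘ σ := by
  funext i
  rfl

theorem termG_two (n p : ℕ) (S : (Fin p → Fin n) → ℝ) (hS : IsPForm n p S) (u : Fin n → ℝ)
    (t : Finset (Fin p)) (i j : Fin p) (hij : i ≠ j) (hi : i ∈ t) (hj : j ∈ t) :
    termG n p S u t = 0 := by
  unfold termG
  rw [Finset.sum_comm]
  refine Finset.sum_eq_zero fun τ _ => ?_
  have e := (slotEquiv n p (Equiv.swap i j)).sum_comp (fun ρ => S ρ * S τ *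
    ∏ k, if k ∈ t then u (ρ k) * u (τ k) else gmet n (ρ k) (τ k))
  have e2 : ∀ ρ : Fin p → Fin n,
      (∏ k, if k ∈ t then u ((ρ ∘ Equiv.swap i j) k) * u (τ k)
        else gmet n ((ρ ∘ Equiv.swap i j) k) (τ k))
      = ∏ k, if k ∈ t then u (ρ k) * u (τ k) else gmet n (ρ k) (τ k) := by
    intro ρ
    have split : ∀ ρ : Fin p → Fin n,
        (∏ k, if k ∈ t then u (ρ k) * u (τ k) else gmet n (ρ k) (τ k))
        = (∏ k, if k ∈ t then u (ρ k) else 1) *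
          ∏ k, if k ∈ t then u (τ k) else gmet n (ρ k) (τ k) := by
      intro ρ
      rw [← Finset.prod_mul_distrib]
      refine Finset.prod_congr rfl fun k _ => ?_
      split_ifs <;> simp
    have hmem : ∀ k, Equiv.swap i j k ∈ t ↔ k ∈ t := by
      intro k
      by_cases h1 : k = i
      · subst h1; simp [hi, hj]
      by_cases h2 : k = j
      · subst h2; simp [hi, hj]
      rw [Equiv.swap_apply_of_ne_of_ne h1 h2]
    rw [split, split]
    congr 1
    · rw [← Equiv.prod_comp (Equiv.swap i j) (fun k => if k ∈ t then u (ρ k) else 1)]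
      refine Finset.prod_congr rfl fun k _ => ?_
      simp only [hmem, Function.comp]
    · refine Finset.prod_congr rfl fun k _ => ?_
      split_ifs with hk
      · rfl
      · have h1 : k ≠ i := fun h => hk (h ▸ hi)
        have h2 : k ≠ j := fun h => hk (h ▸ hj)
        rw [Function.comp, Equiv.swap_apply_of_ne_of_ne h1 h2]
  have hS' : ∀ (σ : Equiv.Perm (Fin p)) (μ : Fin p → Fin n),
    S (μ ∘ σ) = ((Equiv.Perm.sign σ : ℤ) : ℝ) * S μ := hS
  simp only [slotEquiv_apply, e2, hS', Equiv.Perm.sign_swap hij] at e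
  simp only [Units.val_neg, Units.val_one, Int.cast_neg, Int.cast_one, neg_mul, one_mul,
    Finset.sum_neg_distrib] at e
  linarith

theorem termG_single (n p : ℕ) (S : (Fin p → Fin n) → ℝ) (hS : IsPForm n p S) (u : Fin n → ℝ)
    (i j : Fin p) : termG n p S u {i} = termG n p S u {j} := by
  unfold termG
  rw [← (slotEquiv n p (Equiv.swap i j)).sum_comp]
  refine Finset.sum_congr rfl fun ρ _ => ?_
  rw [← (slotEquiv n p (Equiv.swap i j)).sum_comp]
  refine Finset.sum_congr rfl fun τ _ => ?_
  have hS' : ∀ (σ : Equiv.Perm (Fin p)) (μ : Fin p → Fin n),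
    S (μ ∘ σ) = ((Equiv.Perm.sign σ : ℤ) : ℝ) * S μ := hS
  simp only [slotEquiv_apply, hS']
  have hs : (((Equiv.Perm.sign (Equiv.swap i j) : ℤˣ) : ℤ) : ℝ) *
      (((Equiv.Perm.sign (Equiv.swap i j) : ℤˣ) : ℤ) : ℝ) = 1 := by
    rw [← Int.cast_mul, ← Units.val_mul, Int.units_mul_self]; simp
  have hp : (∏ k, if k ∈ ({i} : Finset (Fin p)) then
        u ((ρ ∘ Equiv.swap i j) k) * u ((τ ∘ Equiv.swap i j) k)
        else gmet n ((ρ ∘ Equiv.swap i j) k) ((τ ∘ Equiv.swap i j) k))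
      = ∏ k, if k ∈ ({j} : Finset (Fin p)) then u (ρ k) * u (τ k) else gmet n (ρ k) (τ k) := by
    rw [← Equiv.prod_comp (Equiv.swap i j)
      (fun k => if k ∈ ({j} : Finset (Fin p)) then u (ρ k) * u (τ k) else gmet n (ρ k) (τ k))]
    refine Finset.prod_congr rfl fun k _ => ?_
    have : Equiv.swap i j k = j ↔ k = i := by
      rw [Equiv.swap_apply_eq_iff, Equiv.swap_apply_right]
    simp only [Finset.mem_singleton, this, Function.comp]
  rw [hp]
  linear_combination (S ρ * S τ * ∏ k, if k ∈ ({j} : Finset (Fin p)) then u (ρ k) * u (τ k)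
    else gmet n (ρ k) (τ k)) * hs

theorem expand (n p : ℕ) (hp : 0 < p) (S : (Fin p → Fin n) → ℝ) (hS : IsPForm n p S)
    (u : Fin n → ℝ) (c : ℝ) :
    ∑ ρ : Fin p → Fin n, ∑ τ : Fin p → Fin n,
      S ρ * S τ * ∏ i, (gmet n (ρ i) (τ i) + c * (u (ρ i) * u (τ i)))
    = fullContract n p S + c * p * termG n p S u {⟨0, hp⟩} := by
  have e1 : ∀ ρ τ : Fin p → Fin n, ∏ i, (gmet n (ρ i) (τ i) + c * (u (ρ i) * u (τ i)))
      = ∑ t : Finset (Fin p), c ^ t.card *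
        ∏ k, if k ∈ t then u (ρ k) * u (τ k) else gmet n (ρ k) (τ k) := by
    intro ρ τ
    simp only [add_comm (gmet n _ _)]
    rw [Fintype.prod_add]
    refine Finset.sum_congr rfl fun t _ => ?_
    rw [Finset.prod_mul_distrib, Finset.prod_const, mul_assoc]
    congr 1
    rw [Finset.prod_ite]
    congr 1
    · exact Finset.prod_congr (by ext; simp) fun _ _ => rfl
    · exact Finset.prod_congr (by ext; simp) fun _ _ => rfl
  have e2 : ∑ ρ : Fin p → Fin n, ∑ τ : Fin p → Fin n,
      S ρ * S τ * ∏ i, (gmet n (ρ i) (τ i) + c * (u (ρ i) * u (τ i)))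
      = ∑ t : Finset (Fin p), c ^ t.card * termG n p S u t := by
    simp only [e1, termG, Finset.mul_sum]
    rw [Finset.sum_comm (s := (Finset.univ : Finset (Finset (Fin p))))]
    refine Finset.sum_congr rfl fun ρ _ => ?_
    rw [Finset.sum_comm (s := (Finset.univ : Finset (Finset (Fin p))))]
    refine Finset.sum_congr rfl fun τ _ => Finset.sum_congr rfl fun t _ => ?_
    ring
  rw [e2]
  have hnot : (∅ : Finset (Fin p)) ∉
      (Finset.univ : Finset (Fin p)).image (fun i => ({i} : Finset (Fin p))) := by
    simp
  rw [← Finset.sum_subset (Finset.subset_univ (insert ∅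
    ((Finset.univ : Finset (Fin p)).image (fun i => ({i} : Finset (Fin p))))))]
  · rw [Finset.sum_insert hnot,
      Finset.sum_image (fun _ _ _ _ h => Finset.singleton_injective h)]
    congr 1
    · simp [termG, fullContract]
    · rw [Finset.sum_congr rfl (fun i _ => by
        rw [termG_single n p S hS u i ⟨0, hp⟩, Finset.card_singleton, pow_one])]
      simp
      ring
  · intro t _ ht
    have h2 : 1 < t.card := by
      by_contra hcon
      have h3 : t.card = 0 ∨ t.card = 1 := by omega
      apply ht
      rcases h3 with h3 | h3
      · rw [Finset.card_eq_zero] at h3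
        simp [h3]
      · rw [Finset.card_eq_one] at h3
        obtain ⟨a, rfl⟩ := h3
        simp
    obtain ⟨i, hi, j, hj, hij⟩ := Finset.one_lt_card.1 h2
    rw [termG_two n p S hS u t i j hij hi hj, mul_zero]

theorem partContract_uu (n p : ℕ) (hp : 0 < p) (S : (Fin p → Fin n) → ℝ) (u : Fin n → ℝ) :
    ∑ lam, ∑ mu, partContract n p hp S lam mu * u lam * u mu = termG n p S u {⟨0, hp⟩} := by
  have e : ∀ ρ τ : Fin p → Fin n,
      (∏ k, if k ∈ ({⟨0, hp⟩} : Finset (Fin p)) then u (ρ k) * u (τ k) else gmet n (ρ k) (τ k))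
      = u (ρ ⟨0, hp⟩) * u (τ ⟨0, hp⟩) *
        ∏ i ∈ Finset.univ.filter (fun i => i ≠ (⟨0, hp⟩ : Fin p)), gmet n (ρ i) (τ i) := by
    intro ρ τ
    rw [Finset.prod_ite]
    congr 1
    · rw [show (Finset.univ.filter fun k : Fin p => k ∈ ({⟨0, hp⟩} : Finset (Fin p)))
        = {⟨0, hp⟩} by ext; simp]
      simp
    · exact Finset.prod_congr (by ext; simp) fun _ _ => rfl
  simp only [termG, e, partContract, Finset.sum_mul]
  calc _ = ∑ lam : Fin n, ∑ ρ : Fin p → Fin n, ∑ mu : Fin n, ∑ τ : Fin p → Fin n, _ :=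
        Finset.sum_congr rfl fun _ _ => Finset.sum_comm
    _ = ∑ ρ : Fin p → Fin n, ∑ lam : Fin n, ∑ mu : Fin n, ∑ τ : Fin p → Fin n, _ :=
        Finset.sum_comm
    _ = ∑ ρ : Fin p → Fin n, ∑ lam : Fin n, ∑ τ : Fin p → Fin n, ∑ mu : Fin n, _ :=
        Finset.sum_congr rfl fun _ _ => Finset.sum_congr rfl fun _ _ => Finset.sum_comm
    _ = ∑ ρ : Fin p → Fin n, ∑ τ : Fin p → Fin n, ∑ lam : Fin n, ∑ mu : Fin n, _ :=
        Finset.sum_congr rfl fun _ _ => Finset.sum_comm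
    _ = _ := by
      refine Finset.sum_congr rfl fun ρ _ => Finset.sum_congr rfl fun τ _ => ?_
      simp only [ite_and, ite_mul, zero_mul]
      rw [Finset.sum_eq_single (ρ ⟨0, hp⟩), Finset.sum_eq_single (τ ⟨0, hp⟩)]
      · simp; ring
      · intro b _ hb; simp [hb.symm]
      · simp
      · intro b _ hb; simp [hb.symm]
      · simp

theorem density_eq (n p : ℕ) (hp : 0 < p) (S : (Fin p → Fin n) → ℝ) (hS : IsPForm n p S)
    (u : Fin n → ℝ) (hu : minkSq n u < 0) :
    ∑ lam : Fin n, ∑ mu : Fin n, seT n p hp S lam mu * u lam * u mu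
    = (-minkSq n u) / (2 * (p.factorial : ℝ)) *
      ∑ ρ : Fin p → Fin n, ∑ τ : Fin p → Fin n,
      S ρ * S τ * ∏ i, (gmet n (ρ i) (τ i) + 2 / (-minkSq n u) * (u (ρ i) * u (τ i))) := by
  rw [expand n p hp S hS]
  have e : ∑ lam : Fin n, ∑ mu : Fin n, seT n p hp S lam mu * u lam * u mu
      = (1 / ((p - 1).factorial : ℝ)) * termG n p S u {⟨0, hp⟩}
        - (1 / (2 * (p.factorial : ℝ))) * fullContract n p S * minkSq n u := by
    rw [← partContract_uu, minkSq, Finset.mul_sum, Finset.mul_sum, ← Finset.sum_sub_distrib]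
    refine Finset.sum_congr rfl fun lam _ => ?_
    rw [Finset.mul_sum, Finset.mul_sum, ← Finset.sum_sub_distrib]
    refine Finset.sum_congr rfl fun mu _ => ?_
    rw [seT]
    ring
  rw [e]
  have hf : (p.factorial : ℝ) = p * ((p - 1).factorial : ℝ) := by
    rw [← Nat.cast_mul, Nat.mul_factorial_pred hp.ne']
  have hp0 : (p : ℝ) ≠ 0 := by exact_mod_cast hp.ne'
  have hq0 : ((p - 1).factorial : ℝ) ≠ 0 := by positivity
  have hN : minkSq n u ≠ 0 := hu.ne
  rw [hf]
  field_simp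
  ring

/-- the super-energy density `W_Σ(u) = T{Σ}_{λμ} u^λ u^μ` is non-negative for
every timelike `u`, and if it vanishes for some timelike `u` then `Σ = 0` (and hence the whole
super-energy tensor vanishes). -/
theorem seDensity_nonneg_and_definite
    (n p : ℕ) (hp : 1 ≤ p) (hpn : p ≤ n)
    (S : (Fin p → Fin n) → ℝ) (hS : IsPForm n p S) :
    (∀ u : Fin n → ℝ, minkSq n u < 0 →
        0 ≤ ∑ lam : Fin n, ∑ mu : Fin n, seT n p hp S lam mu * u lam * u mu) ∧
    (∀ u : Fin n → ℝ, minkSq n u < 0 →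
        (∑ lam : Fin n, ∑ mu : Fin n, seT n p hp S lam mu * u lam * u mu) = 0 →
        S = 0 ∧ ∀ lam mu : Fin n, seT n p hp S lam mu = 0) := by
  have hn : 0 < n := lt_of_lt_of_le hp hpn
  constructor
  · intro u hu
    obtain ⟨B, C, _, hB⟩ := hmet_factor n hn u hu
    rw [density_eq n p hp S hS u hu, quad_factor n p S _ B hB]
    have : 0 < -minkSq n u := by linarith
    exact mul_nonneg (by positivity) (Finset.sum_nonneg fun _ _ => sq_nonneg _)
  · intro u hu h0
    obtain ⟨B, C, hCB, hB⟩ := hmet_factor n hn u hu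
    rw [density_eq n p hp S hS u hu, quad_factor n p S _ B hB] at h0
    have hN : 0 < -minkSq n u := by linarith
    have hc : 0 < (-minkSq n u) / (2 * (p.factorial : ℝ)) := by positivity
    have h1 := (mul_eq_zero.1 h0).resolve_left hc.ne'
    rw [Finset.sum_eq_zero_iff_of_nonneg (fun _ _ => sq_nonneg _)] at h1
    have hS0 : S = 0 := transform_inj n p S B C hCB fun κ => by
      simpa using h1 κ (Finset.mem_univ _)
    refine ⟨hS0, fun lam mu => ?_⟩
    subst hS0
    simp [seT, partContract, fullContract]
end
end

section
/- Let 1 ≤ p ≤ n, let Σ be a p-form on n-dimensional Minkowski space, and let e : Fin n → ℝⁿ be an orthonormal basis, i.e. η_{μν} e_a^μ e_b^ν = η_{ab} for all a, b ∈ Fin n. Then the super-energy density relative to e₀ equals half the sum of the squares of all components of Σ in that basis: T{Σ}_{λμ} e₀^λ e₀^μ = (1/(2·p!)) · ∑_{a₁,…,a_p ∈ Fin n} ( Σ_{μ₁…μ_p} e_{a₁}^{μ₁} ⋯ e_{a_p}^{μ_p} )². -/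
open Finset

noncomputable section

/-- Components of `S` in the basis `e`. -/
def comp (n p : ℕ) (S : (Fin p → Fin n) → ℝ) (e : Fin n → Fin n → ℝ) (a : Fin p → Fin n) : ℝ :=
  ∑ μ : Fin p → Fin n, S μ * ∏ i : Fin p, e (a i) (μ i)

lemma comp_perm {n p : ℕ} {S : (Fin p → Fin n) → ℝ} (hS : IsPForm n p S)
    (e : Fin n → Fin n → ℝ) (a : Fin p → Fin n) (σ : Equiv.Perm (Fin p)) :
    comp n p S e (a ∘ σ) = ((Equiv.Perm.sign σ : ℤ) : ℝ) * comp n p S e a := by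
  unfold comp
  rw [Finset.mul_sum]
  rw [← Equiv.sum_comp (Equiv.arrowCongr σ.symm (Equiv.refl (Fin n)))]
  apply Finset.sum_congr rfl
  intro μ _
  have h1 : (Equiv.arrowCongr σ.symm (Equiv.refl (Fin n))) μ = μ ∘ σ := by
    ext i; simp [Equiv.arrowCongr]
  rw [h1, hS σ μ]
  have h2 : ∏ i : Fin p, e ((a ∘ σ) i) ((μ ∘ σ) i) = ∏ i : Fin p, e (a i) (μ i) :=
    Equiv.prod_comp σ (fun i => e (a i) (μ i))
  rw [h2]; ring

lemma comp_swap_sq {n p : ℕ} {S : (Fin p → Fin n) → ℝ} (hS : IsPForm n p S)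
    (e : Fin n → Fin n → ℝ) (a : Fin p → Fin n) (σ : Equiv.Perm (Fin p)) :
    comp n p S e (a ∘ σ) ^ 2 = comp n p S e a ^ 2 := by
  rw [comp_perm hS]
  rcases Int.units_eq_one_or (Equiv.Perm.sign σ) with h | h <;> simp [h]

lemma comp_zero {n p : ℕ} {S : (Fin p → Fin n) → ℝ} (hS : IsPForm n p S)
    (e : Fin n → Fin n → ℝ) (a : Fin p → Fin n) (i j : Fin p) (hij : i ≠ j) (h : a i = a j) :
    comp n p S e a = 0 := by
  have h1 := comp_perm hS e a (Equiv.swap i j)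
  have h2 : a ∘ (Equiv.swap i j) = a := by
    ext k
    simp only [Function.comp, Equiv.swap_apply_def]
    split_ifs with h3 h4
    · rw [h3, h]
    · rw [h4, h]
    · rfl
  rw [h2, Equiv.Perm.sign_swap hij] at h1
  simp at h1
  linarith

lemma quad_expand {n p : ℕ} (S : (Fin p → Fin n) → ℝ)
    (e : Fin n → Fin n → ℝ) (w : Fin p → Fin n → ℝ) :
    ∑ ρ : Fin p → Fin n, ∑ τ : Fin p → Fin n,
      S ρ * S τ * ∏ i : Fin p, (∑ a, w i a * e a (ρ i) * e a (τ i))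
    = ∑ a : Fin p → Fin n, (∏ i, w i (a i)) * comp n p S e a ^ 2 := by
  have h : ∀ ρ τ : Fin p → Fin n, ∏ i : Fin p, (∑ a, w i a * e a (ρ i) * e a (τ i))
      = ∑ a : Fin p → Fin n, (∏ i, w i (a i)) * (∏ i, e (a i) (ρ i)) * ∏ i, e (a i) (τ i) := by
    intro ρ τ
    rw [Finset.prod_univ_sum, Fintype.piFinset_univ]
    simp only [Finset.prod_mul_distrib]
  simp only [h, Finset.mul_sum]
  have h3 : ∀ a : Fin p → Fin n, (∏ i, w i (a i)) * comp n p S e a ^ 2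
     = ∑ ρ : Fin p → Fin n, ∑ τ : Fin p → Fin n, S ρ * S τ *
       ((∏ i, w i (a i)) * (∏ i, e (a i) (ρ i)) * ∏ i, e (a i) (τ i)) := by
    intro a
    unfold comp
    rw [sq, Finset.sum_mul_sum, Finset.mul_sum]
    refine Finset.sum_congr rfl fun ρ _ => ?_
    rw [Finset.mul_sum]
    refine Finset.sum_congr rfl fun τ _ => ?_
    ring
  simp only [h3]
  rw [Finset.sum_comm' (t' := univ) (s' := fun _ => univ) (by simp)]
  conv_rhs => rw [Finset.sum_comm]
  rw [Finset.sum_comm]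
  refine Finset.sum_congr rfl fun ρ _ => ?_
  exact Finset.sum_comm

lemma gmet_sum {n : ℕ} (f : Fin n → ℝ) (a : Fin n) :
    ∑ b, gmet n a b * f b = gmet n a a * f a := by
  rw [Finset.sum_eq_single a]
  · intro b _ hb
    simp [gmet, Ne.symm hb]
  · simp

lemma completeness {n : ℕ} (e : Fin n → Fin n → ℝ)
    (hON : ∀ a b : Fin n,
      (∑ μ : Fin n, ∑ ν : Fin n, gmet n μ ν * e a μ * e b ν) = gmet n a b) (μ ν : Fin n) :
    gmet n μ ν = ∑ a, gmet n a a * e a μ * e a ν := by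
  let G : Matrix (Fin n) (Fin n) ℝ := Matrix.diagonal (fun a => gmet n a a)
  let E : Matrix (Fin n) (Fin n) ℝ := Matrix.of e
  have hG : ∀ a b, G a b = gmet n a b := by
    intro a b
    simp only [G, Matrix.diagonal_apply, gmet]
    split_ifs <;> simp_all
  have hGG : G * G = 1 := by
    simp only [G, Matrix.diagonal_mul_diagonal]
    rw [← Matrix.diagonal_one]
    congr 1
    ext a
    simp only [gmet]; split_ifs <;> simp_all
  have h1 : E * G * E.transpose = G := by
    ext a b
    rw [hG, ← hON a b, Matrix.mul_apply]
    refine Finset.sum_congr rfl fun μ _ => ?_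
    simp only [mul_assoc]
    rw [gmet_sum (fun ν => e a μ * e b ν)]
    simp only [G, E, Matrix.mul_diagonal, Matrix.transpose_apply, Matrix.of_apply]
    ring
  have h2 : (E * G) * (E.transpose * G) = 1 := by
    rw [← mul_assoc, h1, hGG]
  have h3 := mul_eq_one_comm.mp h2
  have h4 : E.transpose * G * E = G := by
    calc E.transpose * G * E = (E.transpose * G * (E * G)) * G := by
          rw [mul_assoc (E.transpose * G), mul_assoc E, hGG, mul_one]
      _ = G := by rw [h3, one_mul]
  rw [← hG, ← h4, Matrix.mul_apply]
  refine Finset.sum_congr rfl fun a _ => ?_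
  simp only [G, E, Matrix.mul_diagonal, Matrix.transpose_apply, Matrix.of_apply]
  ring

/-- Weights selecting the index `z` in slot `j` and the metric signs elsewhere. -/
def wt (n p : ℕ) (z : Fin n) (j i : Fin p) (a : Fin n) : ℝ :=
  if i = j then (if a = z then 1 else 0) else gmet n a a

lemma gmet_ne {n : ℕ} (z : Fin n) (hz : (z : ℕ) = 0) (a : Fin n) (h : a ≠ z) : gmet n a a = 1 := by
  have : (a : ℕ) ≠ 0 := fun h' => h (Fin.ext (by omega))
  simp [gmet, this]

lemma pointwise {n p : ℕ} {S : (Fin p → Fin n) → ℝ} (hS : IsPForm n p S)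
    (e : Fin n → Fin n → ℝ) (z : Fin n) (hz : (z : ℕ) = 0) (a : Fin p → Fin n) :
    ∑ j, (∏ i, wt n p z j i (a i)) * comp n p S e a ^ 2
      = (1 - ∏ i, gmet n (a i) (a i)) / 2 * comp n p S e a ^ 2 := by
  by_cases hinj : Function.Injective a
  · rw [← Finset.sum_mul]
    congr 1
    by_cases hj : ∃ j, a j = z
    · obtain ⟨j, hj⟩ := hj
      have hne : ∀ i, i ≠ j → a i ≠ z := fun i hi h => hi (hinj (h.trans hj.symm))
      rw [Finset.sum_eq_single j]
      · rw [Finset.prod_eq_one, Finset.prod_eq_single j]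
        · have : gmet n (a j) (a j) = -1 := by rw [hj]; simp [gmet, hz]
          rw [this]; norm_num
        · intro i _ hi
          exact gmet_ne z hz _ (hne i hi)
        · simp
        · intro i _
          unfold wt
          split_ifs with h1 h2
          · rfl
          · exact absurd (h1 ▸ hj) h2
          · exact gmet_ne z hz _ (hne i h1)
      · intro k _ hk
        apply Finset.prod_eq_zero (Finset.mem_univ k)
        simp [wt, hne k hk]
      · simp
    · push Not at hj
      rw [Finset.sum_eq_zero, Finset.prod_eq_one]
      · norm_num
      · intro i _
        exact gmet_ne z hz _ (hj i)
      · intro k _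
        apply Finset.prod_eq_zero (Finset.mem_univ k)
        simp [wt, hj k]
  · have : comp n p S e a = 0 := by
      simp only [Function.Injective] at hinj
      push Not at hinj
      obtain ⟨i, j, h, hij⟩ := hinj
      exact comp_zero hS e a i j hij h
    simp [this]

lemma slot_indep {n p : ℕ} {S : (Fin p → Fin n) → ℝ} (hS : IsPForm n p S)
    (e : Fin n → Fin n → ℝ) (z : Fin n) (j k : Fin p) :
    ∑ a : Fin p → Fin n, (∏ i, wt n p z j i (a i)) * comp n p S e a ^ 2
      = ∑ a : Fin p → Fin n, (∏ i, wt n p z k i (a i)) * comp n p S e a ^ 2 := by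
  rw [← Equiv.sum_comp (Equiv.arrowCongr (Equiv.swap j k).symm (Equiv.refl (Fin n)))]
  refine Finset.sum_congr rfl fun a _ => ?_
  have h1 : (Equiv.arrowCongr (Equiv.swap j k).symm (Equiv.refl (Fin n))) a
      = a ∘ (Equiv.swap j k) := by
    ext i; simp [Equiv.arrowCongr]
  rw [h1, comp_swap_sq hS]
  congr 1
  rw [← Equiv.prod_comp (Equiv.swap j k) (fun i => wt n p z k i (a i))]
  refine Finset.prod_congr rfl fun i _ => ?_
  have : Equiv.swap j k i = k ↔ i = j := by
    rw [Equiv.swap_apply_eq_iff, Equiv.swap_apply_right]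
  simp only [wt, Function.comp, this]

lemma part_eq_s4 {n p : ℕ} (hp : 0 < p) (S : (Fin p → Fin n) → ℝ)
    (e : Fin n → Fin n → ℝ) (z : Fin n)
    (hC : ∀ μ ν, gmet n μ ν = ∑ a, gmet n a a * e a μ * e a ν) :
    ∑ lam : Fin n, ∑ mu : Fin n, partContract n p hp S lam mu * e z lam * e z mu
      = ∑ a : Fin p → Fin n, (∏ i, wt n p z ⟨0, hp⟩ i (a i)) * comp n p S e a ^ 2 := by
  rw [← quad_expand]
  have h1 : ∀ lam mu : Fin n, partContract n p hp S lam mu * e z lam * e z mu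
     = ∑ ρ : Fin p → Fin n, ∑ τ : Fin p → Fin n,
    if ρ ⟨0, hp⟩ = lam ∧ τ ⟨0, hp⟩ = mu then
      S ρ * S τ * ((e z (ρ ⟨0, hp⟩) * e z (τ ⟨0, hp⟩)) *
        ∏ i ∈ Finset.univ.filter (fun i => i ≠ (⟨0, hp⟩ : Fin p)), gmet n (ρ i) (τ i))
    else 0 := by
    intro lam mu
    unfold partContract
    simp only [Finset.sum_mul]
    refine Finset.sum_congr rfl fun ρ _ => Finset.sum_congr rfl fun τ _ => ?_
    split_ifs with h
    · rw [h.1, h.2]; ring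
    · simp
  simp only [h1]
  have h2 : ∀ F : Fin n → Fin n → (Fin p → Fin n) → (Fin p → Fin n) → ℝ,
      ∑ lam, ∑ mu, ∑ ρ, ∑ τ, F lam mu ρ τ = ∑ ρ, ∑ τ, ∑ lam, ∑ mu, F lam mu ρ τ := by
    intro F
    calc _ = ∑ lam, ∑ ρ, ∑ mu, ∑ τ, F lam mu ρ τ :=
          Finset.sum_congr rfl fun _ _ => Finset.sum_comm
      _ = ∑ ρ, ∑ lam, ∑ mu, ∑ τ, F lam mu ρ τ := Finset.sum_comm
      _ = ∑ ρ, ∑ lam, ∑ τ, ∑ mu, F lam mu ρ τ :=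
          Finset.sum_congr rfl fun _ _ => Finset.sum_congr rfl fun _ _ => Finset.sum_comm
      _ = _ := Finset.sum_congr rfl fun _ _ => Finset.sum_comm
  rw [h2]
  refine Finset.sum_congr rfl fun ρ _ => Finset.sum_congr rfl fun τ _ => ?_
  simp only [ite_and, Finset.sum_ite_eq, Finset.mem_univ, if_true, Finset.sum_ite_irrel,
    Finset.sum_const_zero]
  congr 1
  rw [← Finset.mul_prod_erase univ _ (Finset.mem_univ (⟨0, hp⟩ : Fin p))]
  congr 1
  · simp [wt]
  · rw [← Finset.filter_ne']
    refine Finset.prod_congr rfl fun i hi => ?_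
    have hi' : i ≠ ⟨0, hp⟩ := by simpa using hi
    rw [hC]
    simp [wt, hi']

/-- in any orthonormal basis, the super-energy density relative to `e₀` equals
half the sum of the squares of all the components of `Σ` in that basis. -/
theorem seDensity_orthonormal_basis
    (n p : ℕ) (hp : 1 ≤ p) (hpn : p ≤ n)
    (S : (Fin p → Fin n) → ℝ) (hS : IsPForm n p S)
    (e : Fin n → Fin n → ℝ)
    (hON : ∀ a b : Fin n,
      (∑ μ : Fin n, ∑ ν : Fin n, gmet n μ ν * e a μ * e b ν) = gmet n a b) :
    (∑ lam : Fin n, ∑ mu : Fin n,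
        seT n p hp S lam mu * e ⟨0, by omega⟩ lam * e ⟨0, by omega⟩ mu)
      = (1 / (2 * (p.factorial : ℝ))) *
          ∑ a : Fin p → Fin n,
            (∑ μ : Fin p → Fin n, S μ * ∏ i : Fin p, e (a i) (μ i)) ^ 2 := by
  have hC := completeness e hON
  set z : Fin n := ⟨0, by omega⟩ with hz
  have hpart := part_eq_s4 hp S e z hC
  have hfull : fullContract n p S
      = ∑ a : Fin p → Fin n, (∏ i, gmet n (a i) (a i)) * comp n p S e a ^ 2 := by
    rw [← quad_expand S e (fun _ a => gmet n a a)]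
    unfold fullContract
    simp only [← hC]
  have hsum : (p : ℝ) * ∑ a : Fin p → Fin n, (∏ i, wt n p z ⟨0, hp⟩ i (a i)) * comp n p S e a ^ 2
      = ∑ a : Fin p → Fin n, (1 - ∏ i, gmet n (a i) (a i)) / 2 * comp n p S e a ^ 2 := by
    simp only [← pointwise hS e z rfl]
    rw [Finset.sum_comm, Finset.sum_congr rfl fun j _ => slot_indep hS e z j ⟨0, hp⟩]
    simp
  have hg : ∑ lam : Fin n, ∑ mu : Fin n, gmet n lam mu * e z lam * e z mu = -1 := by
    rw [hON]; simp [gmet, hz]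
  have hL : (∑ lam : Fin n, ∑ mu : Fin n, seT n p hp S lam mu * e z lam * e z mu)
      = (1 / ((p - 1).factorial : ℝ)) *
        (∑ lam : Fin n, ∑ mu : Fin n, partContract n p hp S lam mu * e z lam * e z mu)
        - (1 / (2 * (p.factorial : ℝ))) * fullContract n p S *
          ∑ lam : Fin n, ∑ mu : Fin n, gmet n lam mu * e z lam * e z mu := by
    simp only [Finset.mul_sum, ← Finset.sum_sub_distrib]
    refine Finset.sum_congr rfl fun lam _ => Finset.sum_congr rfl fun mu _ => ?_
    unfold seT
    ring
  rw [hL, hg, hpart, hfull]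
  change _ = _ * ∑ a : Fin p → Fin n, comp n p S e a ^ 2
  have hR : ∑ a : Fin p → Fin n, (1 - ∏ i, gmet n (a i) (a i)) / 2 * comp n p S e a ^ 2
      = (∑ a : Fin p → Fin n, comp n p S e a ^ 2
        - ∑ a : Fin p → Fin n, (∏ i, gmet n (a i) (a i)) * comp n p S e a ^ 2) / 2 := by
    rw [← Finset.sum_sub_distrib, Finset.sum_div]
    refine Finset.sum_congr rfl fun a _ => ?_
    ring
  rw [hR] at hsum
  have hfac : (p.factorial : ℝ) = p * ((p - 1).factorial : ℝ) := by
    rw [← Nat.mul_factorial_pred (by omega : p ≠ 0)]; push_cast; ring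
  have hp0 : (p : ℝ) ≠ 0 := by positivity
  have hf0 : ((p - 1).factorial : ℝ) ≠ 0 := by positivity
  rw [hfac]
  field_simp
  linarith
end
end

section
/- Let 1 ≤ p ≤ n, let Σ be a p-form on n-dimensional Minkowski space, let u be a unit timelike vector, and set h^{μν} = η^{μν} + 2u^μu^ν (a positive-definite metric). Then the super-energy density of Σ relative to u equals the h-square of Σ: T{Σ}_{λμ} u^λ u^μ = (1/(2·p!)) · Σ_{μ₁…μ_p} Σ_{ν₁…ν_p} h^{μ₁ν₁} ⋯ h^{μ_pν_p}. -/
open Finset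

noncomputable section

/-- Components of the positive-definite metric `h^{μν} = η^{μν} + 2 u^μ u^ν`. -/
def hInv (n : ℕ) (u : Fin n → ℝ) (μ ν : Fin n) : ℝ :=
  gmet n μ ν + 2 * u μ * u ν

/-- Term of the expanded `h`-square in which the slots of `T` carry `2 u u`. -/
def hTerm (n p : ℕ) (S : (Fin p → Fin n) → ℝ) (u : Fin n → ℝ) (T : Finset (Fin p)) : ℝ :=
  ∑ μ : Fin p → Fin n, ∑ ν : Fin p → Fin n,
    S μ * S ν * ((∏ i ∈ T, 2 * u (μ i) * u (ν i)) * ∏ i ∈ univ \ T, gmet n (μ i) (ν i))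

theorem swap_form {n p : ℕ} {S : (Fin p → Fin n) → ℝ} (hS : IsPForm n p S)
    {i j : Fin p} (hij : i ≠ j) (μ : Fin p → Fin n) : S (μ ∘ Equiv.swap i j) = - S μ := by
  rw [hS, Equiv.Perm.sign_swap hij]; simp

theorem sum_reindex {n p : ℕ} (σ : Equiv.Perm (Fin p)) (f : (Fin p → Fin n) → ℝ) :
    ∑ μ, f μ = ∑ μ, f (μ ∘ σ) := by
  symm
  exact Equiv.sum_comp (Equiv.arrowCongr σ.symm (Equiv.refl (Fin n))) f

theorem hTerm_vanish {n p : ℕ} {S : (Fin p → Fin n) → ℝ} (hS : IsPForm n p S)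
    (u : Fin n → ℝ) (T : Finset (Fin p)) {i j : Fin p} (hi : i ∈ T) (hj : j ∈ T) (hij : i ≠ j) :
    hTerm n p S u T = 0 := by
  have key : hTerm n p S u T = - hTerm n p S u T := by
    conv_lhs => rw [hTerm, sum_reindex (Equiv.swap i j)]
    rw [hTerm, ← Finset.sum_neg_distrib]
    refine Finset.sum_congr rfl fun μ _ => ?_
    rw [← Finset.sum_neg_distrib]
    refine Finset.sum_congr rfl fun ν _ => ?_
    rw [swap_form hS hij]
    have h1 : ∏ k ∈ T, 2 * u ((μ ∘ Equiv.swap i j) k) * u (ν k)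
        = ∏ k ∈ T, 2 * u (μ k) * u (ν k) := by
      simp only [Finset.prod_mul_distrib]
      congr 2
      refine Finset.prod_equiv (Equiv.swap i j) ?_ (fun k _ => rfl)
      intro k
      by_cases h1 : k = i
      · subst h1; simp [hi, hj]
      by_cases h2 : k = j
      · subst h2; simp [hi, hj]
      rw [Equiv.swap_apply_of_ne_of_ne h1 h2]
    have h2 : ∏ k ∈ univ \ T, gmet n ((μ ∘ Equiv.swap i j) k) (ν k)
        = ∏ k ∈ univ \ T, gmet n (μ k) (ν k) := by
      refine Finset.prod_congr rfl fun k hk => ?_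
      have hk' : k ∉ T := by simpa using hk
      rw [Function.comp_apply, Equiv.swap_apply_of_ne_of_ne]
      · rintro rfl; exact hk' hi
      · rintro rfl; exact hk' hj
    rw [h1, h2]; ring
  linarith

theorem hTerm_single {n p : ℕ} {S : (Fin p → Fin n) → ℝ} (hS : IsPForm n p S)
    (u : Fin n → ℝ) (i j : Fin p) : hTerm n p S u {i} = hTerm n p S u {j} := by
  by_cases hij : i = j
  · rw [hij]
  rw [hTerm, sum_reindex (Equiv.swap i j), hTerm]
  refine Finset.sum_congr rfl fun μ _ => ?_
  rw [sum_reindex (Equiv.swap i j)]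
  refine Finset.sum_congr rfl fun ν _ => ?_
  rw [swap_form hS hij, swap_form hS hij]
  have h2 : ∏ k ∈ univ \ {i}, gmet n ((μ ∘ Equiv.swap i j) k) ((ν ∘ Equiv.swap i j) k)
      = ∏ k ∈ univ \ {j}, gmet n (μ k) (ν k) := by
    refine Finset.prod_equiv (Equiv.swap i j) ?_ (fun k _ => rfl)
    intro k
    simp only [mem_sdiff, mem_univ, true_and, mem_singleton]
    rw [Equiv.swap_apply_eq_iff, Equiv.swap_apply_right]
  rw [h2]
  simp

theorem hSquare_expand {n p : ℕ} (hp : 0 < p) {S : (Fin p → Fin n) → ℝ} (hS : IsPForm n p S)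
    (u : Fin n → ℝ) :
    ∑ μ : Fin p → Fin n, ∑ ν : Fin p → Fin n, S μ * S ν * ∏ i : Fin p, hInv n u (μ i) (ν i)
      = fullContract n p S + p * hTerm n p S u {⟨0, hp⟩} := by
  have h1 : ∑ μ : Fin p → Fin n, ∑ ν : Fin p → Fin n,
      S μ * S ν * ∏ i : Fin p, hInv n u (μ i) (ν i)
      = ∑ T : Finset (Fin p), hTerm n p S u T := by
    simp only [hTerm]
    rw [Finset.sum_comm]
    conv_rhs => rw [Finset.sum_comm]
    rw [Finset.sum_comm]
    refine Finset.sum_congr rfl fun μ _ => ?_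
    conv_rhs => rw [Finset.sum_comm]
    refine Finset.sum_congr rfl fun ν _ => ?_
    rw [← Finset.mul_sum]
    congr 1
    simp only [hInv, add_comm (gmet n _ _)]
    rw [Finset.prod_add, Finset.powerset_univ]
  rw [h1]
  have h2 : ∑ T : Finset (Fin p), hTerm n p S u T
      = ∑ T ∈ insert ∅ (univ.image fun i : Fin p => ({i} : Finset (Fin p))), hTerm n p S u T := by
    symm
    refine Finset.sum_subset (Finset.subset_univ _) fun T _ hT => ?_
    simp only [mem_insert, mem_image, mem_univ, true_and, not_or, not_exists] at hT
    have hne : T.Nonempty := Finset.nonempty_iff_ne_empty.mpr hT.1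
    obtain ⟨i, hi⟩ := hne
    by_cases h : ∃ j ∈ T, i ≠ j
    · obtain ⟨j, hj, hij⟩ := h
      exact hTerm_vanish hS u T hi hj hij
    · push Not at h
      exact absurd (Finset.eq_singleton_iff_unique_mem.mpr ⟨hi, fun j hj => (h j hj).symm⟩).symm
        (hT.2 i)
  rw [h2, Finset.sum_insert (by simp), Finset.sum_image (by intro a _ b _ h; simpa using h)]
  congr 1
  · simp [hTerm, fullContract]
  · rw [Finset.sum_congr rfl fun i _ => hTerm_single hS u i ⟨0, hp⟩]
    simp

theorem part_sum {n p : ℕ} (hp : 0 < p) (S : (Fin p → Fin n) → ℝ) (u : Fin n → ℝ) :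
    2 * ∑ lam : Fin n, ∑ mu : Fin n, partContract n p hp S lam mu * u lam * u mu
      = hTerm n p S u {⟨0, hp⟩} := by
  have h1 : ∀ lam mu : Fin n, partContract n p hp S lam mu * u lam * u mu
      = ∑ ρ : Fin p → Fin n, ∑ τ : Fin p → Fin n,
        if ρ ⟨0, hp⟩ = lam then (if τ ⟨0, hp⟩ = mu then
          S ρ * S τ * (∏ i ∈ univ \ {⟨0, hp⟩}, gmet n (ρ i) (τ i)) * u lam * u mu else 0)
          else 0 := by
    intro lam mu
    rw [partContract, Finset.sum_mul, Finset.sum_mul]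
    refine Finset.sum_congr rfl fun ρ _ => ?_
    rw [Finset.sum_mul, Finset.sum_mul]
    refine Finset.sum_congr rfl fun τ _ => ?_
    have : univ.filter (fun i => i ≠ (⟨0, hp⟩ : Fin p)) = univ \ {⟨0, hp⟩} := by
      ext; simp
    rw [this]
    split_ifs <;> simp_all
  simp only [h1]
  have h2 : ∀ F : Fin n → Fin n → (Fin p → Fin n) → (Fin p → Fin n) → ℝ,
      ∑ a, ∑ b, ∑ ρ, ∑ τ, F a b ρ τ = ∑ ρ, ∑ τ, ∑ a, ∑ b, F a b ρ τ := by
    intro F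
    calc ∑ a, ∑ b, ∑ ρ, ∑ τ, F a b ρ τ
        = ∑ a, ∑ ρ, ∑ b, ∑ τ, F a b ρ τ :=
          Finset.sum_congr rfl fun a _ => Finset.sum_comm
      _ = ∑ ρ, ∑ a, ∑ b, ∑ τ, F a b ρ τ := Finset.sum_comm
      _ = ∑ ρ, ∑ a, ∑ τ, ∑ b, F a b ρ τ :=
          Finset.sum_congr rfl fun ρ _ => Finset.sum_congr rfl fun a _ => Finset.sum_comm
      _ = ∑ ρ, ∑ τ, ∑ a, ∑ b, F a b ρ τ :=
          Finset.sum_congr rfl fun ρ _ => Finset.sum_comm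
  rw [h2, hTerm, Finset.mul_sum]
  refine Finset.sum_congr rfl fun ρ _ => ?_
  rw [Finset.mul_sum]
  refine Finset.sum_congr rfl fun τ _ => ?_
  have h3 : ∀ a : Fin n, (∑ b : Fin n, if ρ ⟨0, hp⟩ = a then (if τ ⟨0, hp⟩ = b then
          S ρ * S τ * (∏ i ∈ univ \ {⟨0, hp⟩}, gmet n (ρ i) (τ i)) * u a * u b else 0) else 0)
      = if ρ ⟨0, hp⟩ = a then
          S ρ * S τ * (∏ i ∈ univ \ {⟨0, hp⟩}, gmet n (ρ i) (τ i)) * u a * u (τ ⟨0, hp⟩)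
        else 0 := by
    intro a
    split_ifs
    · rw [Finset.sum_ite_eq]; simp
    · simp
  rw [Finset.sum_congr rfl fun a _ => h3 a, Finset.sum_ite_eq, Finset.prod_singleton]
  simp only [mem_univ, if_true]
  ring

/-- the super-energy density of `Σ` relative to a unit timelike `u` equals
the `h`-square of `Σ`. -/
theorem seDensity_eq_hSquare
    (n p : ℕ) (hp : 1 ≤ p) (hpn : p ≤ n)
    (S : (Fin p → Fin n) → ℝ) (hS : IsPForm n p S)
    (u : Fin n → ℝ) (hu : minkSq n u = -1) :
    (∑ lam : Fin n, ∑ mu : Fin n, seT n p hp S lam mu * u lam * u mu)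
      = (1 / (2 * (p.factorial : ℝ))) *
          ∑ μ : Fin p → Fin n, ∑ ν : Fin p → Fin n,
            S μ * S ν * ∏ i : Fin p, hInv n u (μ i) (ν i) := by
  rw [hSquare_expand hp hS u, ← part_sum hp S u]
  have h1 : (∑ lam : Fin n, ∑ mu : Fin n, seT n p hp S lam mu * u lam * u mu)
      = (1 / ((p - 1).factorial : ℝ)) *
          (∑ lam : Fin n, ∑ mu : Fin n, partContract n p hp S lam mu * u lam * u mu)
        - (1 / (2 * (p.factorial : ℝ))) * fullContract n p S * minkSq n u := by
    simp only [minkSq, Finset.mul_sum, ← Finset.sum_sub_distrib]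
    refine Finset.sum_congr rfl fun a _ => Finset.sum_congr rfl fun b _ => ?_
    rw [seT]; ring
  rw [h1, hu]
  have h2 : (p.factorial : ℝ) = p * ((p - 1).factorial : ℝ) := by
    exact_mod_cast (Nat.mul_factorial_pred (by omega)).symm
  have h3 : ((p - 1).factorial : ℝ) ≠ 0 := by positivity
  have h4 : (p : ℝ) ≠ 0 := by
    have : p ≠ 0 := by omega
    exact_mod_cast this
  rw [h2]
  field_simp
  ring
end
end
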